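/- arXiv:2310.00931 — 2 statements merged into one kernel-verified Lean document; each statement's English description precedes it below -/
import Mathlib

section
/- Let k ≥ 1, ℓ ≥ 0, D ≥ 0 be integers, let ε > 0 be a real number, and let α ∈ {0,1}. There exists a finite simple graph G with fractional arboricity γ(G) < k + (ℓ(k+1) + α)/((ℓ+1)(k+1) + α) + ε such that in every partition of the edge set of G into k+2−1 = k+1 parts each spanning a pseudoforest, if one of the parts F has maximum degree at most D, then F has a connected component of diameter at least 2ℓ + 1 + α. -/
open SimpleGraph

/-- The set of edges of the connected component `c` of the graph `H`. -/
def compEdges {V : Type*} (H : SimpleGraph V) (c : H.ConnectedComponent) : Set (Sym2 V) :=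
  {e | e ∈ H.edgeSet ∧ ∀ v ∈ e, v ∈ c.supp}

/-- A graph is a pseudoforest if every connected component has at most as many
edges as vertices (equivalently, every component contains at most one cycle). -/
def IsPseudoforest {V : Type*} (H : SimpleGraph V) : Prop :=
  ∀ c : H.ConnectedComponent, (compEdges H c).ncard ≤ c.supp.ncard

/-- `P` is a partition of the edge set of `G` into `m` parts,
each of which spans a pseudoforest. -/
def IsPseudoforestDecomp {V : Type*} (G : SimpleGraph V) (m : ℕ)
    (P : Fin m → Set (Sym2 V)) : Prop :=
  (∀ i, P i ⊆ G.edgeSet) ∧ (∀ i j, i ≠ j → Disjoint (P i) (P j)) ∧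
    (⋃ i, P i) = G.edgeSet ∧ ∀ i, IsPseudoforest (SimpleGraph.fromEdgeSet (P i))

/-- A finite rooted tree (given by a parent map) used as building block. -/
structure Blk (k dd : ℕ) (θ : ℝ) where
  B : Type
  fin : Fintype B
  dec : DecidableEq B
  p : B → Option B
  rank : B → ℕ
  hrank : ∀ b b', p b = some b' → rank b' < rank b
  root : B
  hroot : ∀ b, p b = none → b = root
  df : B → ℕ
  hdf : ∀ b, df b ≤ k
  S : Finset B
  hS : ∑ b, df b + 2 = S.card
  hpot : ∀ s ∈ S, ∃ φ : B → ℕ, φ s = 0 ∧ (∀ t ∈ S, t ≠ s → dd ≤ φ t) ∧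
    ∀ b b', p b = some b' → φ b ≤ φ b' + 1 ∧ φ b' ≤ φ b + 1
  hdens : ∀ χ : B → ℝ, (∀ b, χ b = 0 ∨ χ b = 1) →
    ∑ b, χ b * ((p b).elim 0 χ - df b) ≤ θ * ∑ b, χ b

attribute [instance] Blk.fin Blk.dec

/-- A pseudoforest has at most as many edges as vertices. -/
lemma pseudo_card {V : Type*} [Fintype V] (H : SimpleGraph V) (h : IsPseudoforest H) :
    H.edgeSet.ncard ≤ Fintype.card V := by
  classical
  have h1 : H.edgeSet ⊆ ⋃ c ∈ (Finset.univ : Finset H.ConnectedComponent), compEdges H c := by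
    intro e he
    induction e using Sym2.ind with
    | _ x y =>
      simp only [Finset.mem_univ, Set.iUnion_true, Set.mem_iUnion]
      refine ⟨H.connectedComponentMk x, he, ?_⟩
      intro v hv
      have hxy : H.Adj x y := he
      rcases Sym2.mem_iff.1 hv with rfl | rfl
      · simp
      · simp only [SimpleGraph.ConnectedComponent.mem_supp_iff, SimpleGraph.ConnectedComponent.eq]
        exact hxy.symm.reachable
  have h2 : H.edgeSet.ncard ≤ ∑ c : H.ConnectedComponent, (compEdges H c).ncard :=
    (Set.ncard_le_ncard h1 (Set.toFinite _)).trans (Finset.set_ncard_biUnion_le _ _)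
  refine h2.trans ((Finset.sum_le_sum fun c _ => h c).trans (le_of_eq ?_))
  rw [← Finset.card_univ, Finset.card_eq_sum_card_fiberwise (f := H.connectedComponentMk)
    (t := Finset.univ) (by simp)]
  refine Finset.sum_congr rfl fun c _ => ?_
  rw [← Set.ncard_coe_finset]
  congr 1
  ext v
  simp

/-- The index set of potential edges. -/
abbrev Idx (Q k : ℕ) (B : Type) := (Fin Q × B) ⊕ ((Fin Q × B) × Fin k)

section
variable {k dd : ℕ} {θ : ℝ} (β : Blk k dd θ) {Q n : ℕ}
  (v : Fin Q × β.B → Fin n) (r : Fin k → Fin n)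

/-- The edge with a given index. -/
def ed : Idx Q k β.B → Sym2 (Fin n)
  | .inl x => s(v x, v (x.1, (β.p x.2).getD x.2))
  | .inr y => s(v y.1, r y.2)

/-- The indices that really are used. -/
def val : Idx Q k β.B → Prop
  | .inl x => β.p x.2 ≠ none
  | .inr y => (y.2 : ℕ) < k - β.df y.1.2


lemma ed_inj (hv : Function.Injective v) (hr : Function.Injective r) (hvr : ∀ x j, v x ≠ r j)
    : Set.InjOn (ed β v r) {i | val β i} := by
  rintro (⟨q, b⟩ | ⟨⟨q, b⟩, j⟩) hi (⟨q', b'⟩ | ⟨⟨q', b'⟩, j'⟩) hi' h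
  · simp only [val, Set.mem_ofPred_eq] at hi hi'
    obtain ⟨c, hc⟩ := Option.ne_none_iff_exists'.1 hi
    obtain ⟨c', hc'⟩ := Option.ne_none_iff_exists'.1 hi'
    simp only [ed, hc, hc', Option.getD_some, Sym2.eq_iff, hv.eq_iff, Prod.mk.injEq] at h
    rcases h with ⟨⟨h1, h2⟩, -⟩ | ⟨⟨h1, h2⟩, h3, h4⟩
    · simp [h1, h2]
    · have := β.hrank _ _ hc
      have := β.hrank _ _ hc'
      subst h2 h4
      omega
  · simp only [ed, Sym2.eq_iff] at h
    rcases h with ⟨h1, h2⟩ | ⟨h1, h2⟩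
    · exact absurd h2 (hvr _ _)
    · exact absurd h1 (hvr _ _)
  · simp only [ed, Sym2.eq_iff] at h
    rcases h with ⟨h1, h2⟩ | ⟨h1, h2⟩
    · exact absurd h2.symm (hvr _ _)
    · exact absurd h2.symm (hvr _ _)
  · simp only [ed, Sym2.eq_iff] at h
    rcases h with ⟨h1, h2⟩ | ⟨h1, h2⟩
    · rw [hv h1, hr h2]
    · exact absurd h1 (hvr _ _)

/-- The graph. -/
def gr : SimpleGraph (Fin n) := SimpleGraph.fromEdgeSet (ed β v r '' {i | val β i})

lemma gr_edge (hv : Function.Injective v) (hvr : ∀ x j, v x ≠ r j)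
    : (gr β v r).edgeSet = ed β v r '' {i | val β i} := by
  rw [gr, SimpleGraph.edgeSet_fromEdgeSet]
  refine sdiff_eq_left.2 ?_
  rw [Set.disjoint_left]
  rintro _ ⟨(⟨q, b⟩ | ⟨⟨q, b⟩, j⟩), hi, rfl⟩ h
  · simp only [val, Set.mem_ofPred_eq] at hi
    obtain ⟨c, hc⟩ := Option.ne_none_iff_exists'.1 hi
    simp only [ed, hc, Option.getD_some, Sym2.mem_diagSet, Sym2.mk_isDiag_iff, hv.eq_iff, Prod.mk.injEq] at h
    have := β.hrank _ _ hc
    rw [← h.2] at this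
    omega
  · simp only [ed, Sym2.mem_diagSet, Sym2.mk_isDiag_iff] at h
    exact hvr _ _ h

open Classical in
lemma cnt (hv : Function.Injective v) (hr : Function.Injective r) (hvr : ∀ x j, v x ≠ r j)
    (E : Set (Sym2 (Fin n))) (hE : E ⊆ (gr β v r).edgeSet) :
    E.ncard = (Finset.univ.filter fun i => val β i ∧ ed β v r i ∈ E).card := by
  rw [gr_edge β v r hv hvr] at hE
  rw [← Finset.card_image_of_injOn (f := ed β v r)
    ((ed_inj β v r hv hr hvr).mono (by intro i hi; simp at hi; exact hi.1)),
    ← Set.ncard_coe_finset]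
  congr 1
  ext e
  simp only [Finset.coe_image, Finset.coe_filter, Finset.mem_univ, true_and, Set.mem_image, Set.mem_ofPred_eq]
  constructor
  · intro he
    obtain ⟨i, hi, rfl⟩ := hE he
    exact ⟨i, ⟨hi, he⟩, rfl⟩
  · rintro ⟨i, ⟨_, h⟩, rfl⟩
    exact h

open Classical in
lemma cnt2 (hv : Function.Injective v) (hr : Function.Injective r) (hvr : ∀ x j, v x ≠ r j)
    (E : Set (Sym2 (Fin n))) (hE : E ⊆ (gr β v r).edgeSet) :
    E.ncard = (Finset.univ.filter fun x : Fin Q × β.B =>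
        val β (.inl x : Idx Q k β.B) ∧ ed β v r (.inl x) ∈ E).card +
      (Finset.univ.filter fun y : (Fin Q × β.B) × Fin k =>
        val β (.inr y : Idx Q k β.B) ∧ ed β v r (.inr y) ∈ E).card := by
  rw [cnt β v r hv hr hvr E hE]
  simp only [Finset.card_filter, Fintype.sum_sum_type]


open Classical in
lemma dens (hv : Function.Injective v) (hr : Function.Injective r) (hvr : ∀ x j, v x ≠ r j)
    (hk : 1 ≤ k) (hθ : 0 ≤ θ) (ρ : ℝ) (hρ : k + θ < ρ) (H : (gr β v r).Subgraph)
    (h2 : 2 ≤ H.verts.ncard) :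
    (H.edgeSet.ncard : ℝ) / (H.verts.ncard - 1) < ρ := by
  have hk' : (1 : ℝ) ≤ k := by exact_mod_cast hk
  have h2' : (2 : ℝ) ≤ H.verts.ncard := by exact_mod_cast h2
  rw [div_lt_iff₀ (by linarith)]
  suffices hs : (H.edgeSet.ncard : ℝ) ≤ (k + θ) * (H.verts.ncard - 1) by
    nlinarith
  obtain ⟨E, hE⟩ : ∃ E, E = H.edgeSet := ⟨_, rfl⟩
  rw [← hE, cnt2 β v r hv hr hvr E (hE ▸ H.edgeSet_subset)]
  -- the block vertices of `H`
  set T : Finset (Fin Q × β.B) := Finset.univ.filter fun x => v x ∈ H.verts with hT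
  have hTle : T.card ≤ H.verts.ncard := by
    rw [← Finset.card_image_of_injective T hv, ← Set.ncard_coe_finset]
    refine Set.ncard_le_ncard ?_ (Set.toFinite _)
    intro x hx
    simp [hT] at hx
    obtain ⟨a, b, h, rfl⟩ := hx
    exact h
  set I1 := (Finset.univ.filter fun x : Fin Q × β.B =>
    val β (.inl x : Idx Q k β.B) ∧ ed β v r (.inl x) ∈ E) with hI1
  set I2 := (Finset.univ.filter fun y : (Fin Q × β.B) × Fin k =>
    val β (.inr y : Idx Q k β.B) ∧ ed β v r (.inr y) ∈ E) with hI2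
  have hI1' : ∀ x ∈ I1, x ∈ T ∧ ∃ b', β.p x.2 = some b' ∧ (x.1, b') ∈ T := by
    rintro ⟨q, b⟩ hx
    replace hx := (Finset.mem_filter.1 hx).2
    simp only [val, ed, hE] at hx
    obtain ⟨c, hc⟩ := Option.ne_none_iff_exists'.1 hx.1
    have ha := hx.2
    simp only [hc, Option.getD_some, SimpleGraph.Subgraph.mem_edgeSet] at ha
    simp only [hT, Finset.mem_filter, Finset.mem_univ, true_and]
    exact ⟨ha.fst_mem, c, hc, ha.snd_mem⟩
  have hI2' : ∀ y ∈ I2, y.1 ∈ T ∧ r y.2 ∈ H.verts ∧ (y.2 : ℕ) < k - β.df y.1.2 := by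
    rintro ⟨⟨q, b⟩, j⟩ hx
    replace hx := (Finset.mem_filter.1 hx).2
    simp only [val, ed, hE, SimpleGraph.Subgraph.mem_edgeSet] at hx
    simp only [hT, Finset.mem_filter, Finset.mem_univ, true_and]
    exact ⟨hx.2.fst_mem, hx.2.snd_mem, hx.1⟩
  by_cases hR : ∃ j, r j ∈ H.verts
  · obtain ⟨j₀, hj₀⟩ := hR
    have hTlt : T.card + 1 ≤ H.verts.ncard := by
      have : r j₀ ∉ T.image v := by
        simp only [Finset.mem_image, not_exists, not_and]
        intro x _ h
        exact hvr _ _ h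
      rw [← Finset.card_image_of_injective T hv, ← Finset.card_insert_of_notMem this,
        ← Set.ncard_coe_finset]
      refine Set.ncard_le_ncard ?_ (Set.toFinite _)
      intro x hx
      simp [hT] at hx
      rcases hx with rfl | ⟨a, b, h, rfl⟩
      · exact hj₀
      · exact h
    set χ : Fin Q → β.B → ℝ := fun q b => if (q, b) ∈ T then 1 else 0 with hχ
    have hTsum : (T.card : ℝ) = ∑ q, ∑ b, χ q b := by
      rw [← Fintype.sum_prod_type' (f := χ)]
      simp [hχ]
    have c1 : (I1.card : ℝ) ≤ ∑ q, ∑ b, χ q b * (β.p b).elim 0 (χ q) := by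
      rw [← Fintype.sum_prod_type' (f := fun q b => χ q b * (β.p b).elim 0 (χ q))]
      have : (I1.card : ℝ) = ∑ x : Fin Q × β.B, if x ∈ I1 then 1 else 0 := by simp
      rw [this]
      refine Finset.sum_le_sum fun x _ => ?_
      split_ifs with hx
      · obtain ⟨h1, b', h3, h4⟩ := hI1' x hx
        simp [h3, hχ, h1, h4]
      · rcases h : β.p x.2 with _ | b'
        · simp
        · simp only [hχ, Option.elim_some]
          positivity
    have c2 : (I2.card : ℝ) ≤ ∑ q, ∑ b, χ q b * (k - β.df b) := by
      rw [← Fintype.sum_prod_type' (f := fun q b => χ q b * ((k : ℝ) - β.df b))]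
      rw [Finset.card_eq_sum_card_fiberwise (f := fun y => y.1) (t := Finset.univ) (by simp)]
      push_cast
      refine Finset.sum_le_sum fun x _ => ?_
      by_cases hx : x ∈ T
      · simp only [hχ, hx, if_true, one_mul]
        rw [← Nat.cast_sub (β.hdf _)]
        norm_cast
        calc _ ≤ (Finset.range (k - β.df x.2)).card := by
              refine Finset.card_le_card_of_injOn (fun y => (y.2 : ℕ)) ?_ ?_
              · intro y hy
                simp only [Finset.coe_filter, Set.mem_ofPred_eq] at hy
                have := (hI2' y hy.1).2.2
                rw [hy.2] at this
                simpa using this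
              · intro y hy y' hy' h
                simp only [Finset.coe_filter, Set.mem_ofPred_eq] at hy hy'
                exact Prod.ext (hy.2.trans hy'.2.symm) (Fin.ext h)
          _ = _ := by simp
      · simp only [hχ, hx, if_false, zero_mul]
        norm_cast
        rw [Nat.le_zero, Finset.card_eq_zero, Finset.filter_eq_empty_iff]
        rintro y hy rfl
        exact hx (hI2' y hy).1
    have c3 : ∀ q, ∑ b, χ q b * ((β.p b).elim 0 (χ q) - β.df b) ≤ θ * ∑ b, χ q b := by
      intro q
      refine β.hdens (χ q) fun b => ?_
      simp only [hχ]
      split_ifs <;> simp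
    have c4 := Finset.sum_le_sum fun q (_ : q ∈ Finset.univ) => c3 q
    rw [← Finset.mul_sum, ← hTsum] at c4
    have c5 : ∑ q, ∑ b, χ q b * (β.p b).elim 0 (χ q) + ∑ q, ∑ b, χ q b * ((k : ℝ) - β.df b)
        = ∑ q, ∑ b, χ q b * ((β.p b).elim 0 (χ q) - β.df b) + k * T.card := by
      rw [hTsum, Finset.mul_sum, ← Finset.sum_add_distrib, ← Finset.sum_add_distrib]
      refine Finset.sum_congr rfl fun q _ => ?_
      rw [Finset.mul_sum, ← Finset.sum_add_distrib, ← Finset.sum_add_distrib]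
      refine Finset.sum_congr rfl fun b _ => ?_
      ring
    have c6 : (T.card : ℝ) + 1 ≤ H.verts.ncard := by exact_mod_cast hTlt
    push_cast
    nlinarith
  · push Not at hR
    have e2 : I2 = ∅ := by
      rw [Finset.eq_empty_iff_forall_notMem]
      intro y hy
      exact hR _ (hI2' y hy).2.1
    have e1 : I1.card + 1 ≤ H.verts.ncard := by
      by_cases hTe : T.Nonempty
      · obtain ⟨x, hx, hmin⟩ := T.exists_min_image (fun x => β.rank x.2) hTe
        have hxI : x ∉ I1 := by
          intro h
          obtain ⟨_, b', h3, h4⟩ := hI1' x h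
          have := β.hrank _ _ h3
          have := hmin _ h4
          simp at this
          omega
        rw [← Finset.card_insert_of_notMem hxI]
        refine (Finset.card_le_card ?_).trans hTle
        intro y hy
        rcases Finset.mem_insert.1 hy with rfl | hy
        · exact hx
        · exact (hI1' y hy).1
      · have : I1 = ∅ := by
          rw [Finset.eq_empty_iff_forall_notMem]
          intro y hy
          exact hTe ⟨y, (hI1' y hy).1⟩
        simp [this]
        omega
    have e3 : (I1.card : ℝ) + 1 ≤ H.verts.ncard := by exact_mod_cast e1
    rw [e2]
    push_cast
    simp only [Finset.card_empty, Nat.cast_zero, add_zero]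
    nlinarith

open Classical in
lemma diam (hv : Function.Injective v) (hr : Function.Injective r) (hvr : ∀ x j, v x ≠ r j)
    (D : ℕ) (hn : n = Q * Fintype.card β.B + k)
    (hQ : D * k + k * k + Fintype.card β.B * (D * k) < Q)
    (P : Fin (k + 1) → Set (Sym2 (Fin n))) (hP : IsPseudoforestDecomp (gr β v r) (k + 1) P)
    (i : Fin (k + 1)) (hD : ∀ x : Fin n, {e | e ∈ P i ∧ x ∈ e}.ncard ≤ D) :
    ∃ (K : (SimpleGraph.fromEdgeSet (P i)).ConnectedComponent) (u w : Fin n),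
      u ∈ K.supp ∧ w ∈ K.supp ∧ dd ≤ (SimpleGraph.fromEdgeSet (P i)).dist u w := by
  obtain ⟨hsub, hdisj, hun, hps⟩ := hP
  have hG := gr_edge β v r hv hvr
  have hcard : ∀ j, (P j).ncard ≤ n := by
    intro j
    have := pseudo_card _ (hps j)
    rw [Fintype.card_fin, SimpleGraph.edgeSet_fromEdgeSet] at this
    rwa [sdiff_eq_left.2] at this
    rw [Set.disjoint_left]
    intro e he h
    exact SimpleGraph.not_isDiag_of_mem_edgeSet _ (hsub j he) h
  have hrootnone : β.p β.root = none := by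
    obtain ⟨x, -, hx⟩ := Finset.univ.exists_min_image β.rank ⟨β.root, Finset.mem_univ _⟩
    have hxn : β.p x = none := by
      rcases h : β.p x with _ | y
      · rfl
      · have := β.hrank _ _ h
        have := hx y (Finset.mem_univ _)
        omega
    rwa [← β.hroot x hxn]
  -- total number of edges
  have htot : (gr β v r).edgeSet.ncard + Q * β.S.card =
      Q * (Fintype.card β.B + k * Fintype.card β.B + 1) := by
    obtain ⟨E, hE⟩ : ∃ E, E = (gr β v r).edgeSet := ⟨_, rfl⟩
    rw [← hE, cnt2 β v r hv hr hvr E hE.le]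
    have a1 : (Finset.univ.filter fun x : Fin Q × β.B => val β (.inl x : Idx Q k β.B) ∧
        ed β v r (.inl x) ∈ E).card + Q = Q * Fintype.card β.B := by
      have hfil : (Finset.univ.filter fun x : Fin Q × β.B => val β (.inl x : Idx Q k β.B) ∧
          ed β v r (.inl x) ∈ E) =
          Finset.univ \ (Finset.univ.image fun q : Fin Q => (q, β.root)) := by
        ext ⟨q, b⟩
        simp only [Finset.mem_filter, Finset.mem_univ, true_and, Finset.mem_sdiff,
          Finset.mem_image, Prod.mk.injEq, not_exists, not_and, hE, hG]
        constructor
        · rintro ⟨h, -⟩ q' - rfl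
          exact h hrootnone
        · intro h
          have hval : val β (.inl (q, b) : Idx Q k β.B) := by
            intro hn
            exact h q rfl (β.hroot b hn).symm
          exact ⟨hval, _, hval, rfl⟩
      have hc : (Finset.univ.image fun q : Fin Q => (q, β.root)).card = Q := by
        rw [Finset.card_image_of_injective _ (fun a b h => (Prod.mk.inj h).1)]
        simp
      have := Finset.card_sdiff_add_card_eq_card
        (Finset.subset_univ (Finset.univ.image fun q : Fin Q => (q, β.root)))
      rw [hc] at this
      rw [hfil, this]
      simp
    have a2 : (Finset.univ.filter fun y : (Fin Q × β.B) × Fin k =>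
        val β (.inr y : Idx Q k β.B) ∧ ed β v r (.inr y) ∈ E).card +
        Q * ∑ b, β.df b = Q * (k * Fintype.card β.B) := by
      have hfil : (Finset.univ.filter fun y : (Fin Q × β.B) × Fin k =>
          val β (.inr y : Idx Q k β.B) ∧ ed β v r (.inr y) ∈ E) =
          Finset.univ.filter fun y : (Fin Q × β.B) × Fin k => (y.2 : ℕ) < k - β.df y.1.2 := by
        ext y
        simp only [Finset.mem_filter, Finset.mem_univ, true_and, hE, hG]
        constructor
        · rintro ⟨h, -⟩
          exact h
        · intro h
          exact ⟨h, _, h, rfl⟩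
      have hone : ∀ b : β.B, (∑ j : Fin k, if (j : ℕ) < k - β.df b then 1 else 0) + β.df b = k := by
        intro b
        have := β.hdf b
        rw [Finset.sum_boole, Fin.card_filter_val_lt]
        simp
        omega
      rw [hfil, Finset.card_filter, Fintype.sum_prod_type, Fintype.sum_prod_type]
      have hq : Q * ∑ b, β.df b = ∑ _q : Fin Q, ∑ b, β.df b := by simp
      have hq' : Q * (k * Fintype.card β.B) = ∑ _q : Fin Q, ∑ _b : β.B, k := by simp [mul_comm]
      rw [hq, hq', ← Finset.sum_add_distrib]
      refine Finset.sum_congr rfl fun q _ => ?_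
      rw [← Finset.sum_add_distrib]
      refine Finset.sum_congr rfl fun b _ => ?_
      refine Eq.trans ?_ (hone b)
      congr 1
    rw [← β.hS]
    linarith
  have hsum : (gr β v r).edgeSet.ncard ≤ (P i).ncard + k * n := by
    have h1 : (gr β v r).edgeSet.ncard ≤ ∑ j, (P j).ncard := by
      rw [← hun]
      have : (⋃ j, P j) = ⋃ j ∈ (Finset.univ : Finset (Fin (k + 1))), P j := by simp
      rw [this]
      exact Finset.set_ncard_biUnion_le _ _
    rw [← Finset.add_sum_erase _ _ (Finset.mem_univ i)] at h1
    have h2 : ∑ j ∈ Finset.univ.erase i, (P j).ncard ≤ ∑ j ∈ Finset.univ.erase i, n :=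
      Finset.sum_le_sum fun j _ => hcard j
    simp at h2
    omega
  set inn : Fin Q → ℕ := fun q => (Finset.univ.filter fun b : β.B => β.p b ≠ none ∧
    ed β v r (.inl (q, b)) ∈ P i).card with hinn
  set upp : Fin Q → ℕ := fun q => (Finset.univ.filter fun y : β.B × Fin k =>
    (y.2 : ℕ) < k - β.df y.1 ∧ ed β v r (.inr ((q, y.1), y.2)) ∈ P i).card with hupp
  have hPi : (P i).ncard = ∑ q, inn q + ∑ q, upp q := by
    rw [cnt2 β v r hv hr hvr _ (hsub i)]
    simp only [hinn, hupp, Finset.card_filter, Fintype.sum_prod_type]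
    congr 1
    · exact Finset.sum_congr rfl fun q _ => Finset.sum_congr rfl fun b _ =>
        if_congr Iff.rfl rfl rfl
    · exact Finset.sum_congr rfl fun q _ => Finset.sum_congr rfl fun b _ =>
        Finset.sum_congr rfl fun j _ => if_congr Iff.rfl rfl rfl
  have hup : ∑ q, upp q ≤ D * k := by
    have h1 : ∀ j : Fin k, (∑ x : Fin Q × β.B, if s(v x, r j) ∈ P i then 1 else 0) ≤ D := by
      intro j
      refine le_trans ?_ (hD (r j))
      rw [← Finset.card_filter, ← Finset.card_image_of_injective
        (f := fun x => s(v x, r j)) _ ?_, ← Set.ncard_coe_finset]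
      · refine Set.ncard_le_ncard ?_ (Set.toFinite _)
        intro e he
        simp only [Finset.coe_image, Set.mem_image, Finset.coe_filter, Finset.mem_univ,
          true_and, Set.mem_ofPred_eq] at he
        obtain ⟨x, hx, rfl⟩ := he
        exact ⟨hx, by simp⟩
      · intro x y hxy
        simp only [Sym2.eq_iff] at hxy
        rcases hxy with ⟨h, -⟩ | ⟨h, -⟩
        · exact hv h
        · exact absurd h (hvr _ _)
    have h2 := Finset.sum_le_sum fun j (_ : j ∈ Finset.univ) => h1 j
    rw [Finset.sum_comm, Fintype.sum_prod_type] at h2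
    simp only [Finset.sum_const, Finset.card_univ, Fintype.card_fin, smul_eq_mul] at h2
    rw [mul_comm] at h2
    refine le_trans ?_ h2
    refine Finset.sum_le_sum fun q _ => ?_
    simp only [hupp, Finset.card_filter, Fintype.sum_prod_type]
    refine Finset.sum_le_sum fun b _ => Finset.sum_le_sum fun j _ => ?_
    simp only [ed]
    by_cases ha : s(v (q, b), r j) ∈ P i
    · refine le_trans ?_ (if_pos ha).ge
      by_cases hc : (j : ℕ) < k - β.df b ∧ s(v (q, b), r j) ∈ P i
      · exact (if_pos hc).le
      · exact (if_neg hc).le.trans (Nat.zero_le _)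
    · refine le_trans (if_neg fun h => ha h.2).le (Nat.zero_le _)
  have hex : ∃ q, upp q = 0 ∧ Fintype.card β.B + 1 ≤ inn q + β.S.card := by
    by_contra! hcon
    have hSB : β.S.card ≤ Fintype.card β.B := Finset.card_le_univ _
    have h1 : ∀ q, inn q + β.S.card ≤ Fintype.card β.B + Fintype.card β.B * upp q := by
      intro q
      have hle : inn q ≤ Fintype.card β.B := Finset.card_le_univ _
      rcases Nat.eq_zero_or_pos (upp q) with h | h
      · have := hcon q h
        rw [h]
        omega
      · nlinarith
    have h2 := Finset.sum_le_sum fun q (_ : q ∈ Finset.univ) => h1 q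
    rw [Finset.sum_add_distrib, Finset.sum_add_distrib, ← Finset.mul_sum] at h2
    simp only [Finset.sum_const, Finset.card_univ, Fintype.card_fin, smul_eq_mul] at h2
    have h3 : Fintype.card β.B * ∑ q, upp q ≤ Fintype.card β.B * (D * k) :=
      Nat.mul_le_mul_left _ hup
    have h4 : k * n = k * (Q * Fintype.card β.B) + k * k := by rw [hn]; ring
    have h5 : Q * (Fintype.card β.B + k * Fintype.card β.B + 1) =
      Q * Fintype.card β.B + k * (Q * Fintype.card β.B) + Q := by ring
    omega
  obtain ⟨q, hq0, hq1⟩ := hex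
  set F := SimpleGraph.fromEdgeSet (P i) with hF
  set A := Finset.univ.filter fun b : β.B => β.p b ≠ none ∧ ed β v r (.inl (q, b)) ∈ P i with hA
  have hreach : ∀ m, ∀ b, β.rank b = m → ∃ c, c ∉ A ∧ F.Reachable (v (q, b)) (v (q, c)) := by
    intro m
    induction m using Nat.strong_induction_on with
    | _ m ih =>
      intro b hb
      by_cases hbA : b ∈ A
      · simp only [hA, Finset.mem_filter, Finset.mem_univ, true_and] at hbA
        obtain ⟨b', hb'⟩ := Option.ne_none_iff_exists'.1 hbA.1
        have hlt := β.hrank _ _ hb'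
        obtain ⟨c, hc, hcr⟩ := ih _ (hb ▸ hlt) b' rfl
        refine ⟨c, hc, SimpleGraph.Reachable.trans (SimpleGraph.Adj.reachable ?_) hcr⟩
        rw [hF, SimpleGraph.fromEdgeSet_adj]
        have h1 := hbA.2
        simp only [ed, hb', Option.getD_some] at h1
        refine ⟨h1, ?_⟩
        intro h
        have := hv h
        simp only [Prod.mk.injEq, true_and] at this
        subst this
        omega
      · exact ⟨b, hbA, SimpleGraph.Reachable.refl _⟩
  choose! f hf1 hf2 using fun b => hreach _ b rfl
  have hlt : (Finset.univ \ A).card < β.S.card := by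
    have : (Finset.univ \ A).card + A.card = Fintype.card β.B := by
      rw [Finset.card_sdiff_add_card_eq_card (Finset.subset_univ _), Finset.card_univ]
    have : inn q = A.card := rfl
    omega
  obtain ⟨s, hs, t, ht, hst, hfst⟩ := Finset.exists_ne_map_eq_of_card_lt_of_maps_to hlt
    (f := f) (by intro s _; simpa using hf1 s)
  have hR : F.Reachable (v (q, s)) (v (q, t)) := by
    have h1 := hf2 s
    rw [hfst] at h1
    exact h1.trans (hf2 t).symm
  refine ⟨F.connectedComponentMk (v (q, s)), v (q, s), v (q, t), by simp, ?_, ?_⟩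
  · simpa using hR.symm
  obtain ⟨φ, hφ0, hφ1, hφ2⟩ := β.hpot s hs
  have key : ∀ (x y : Fin n) (W : F.Walk x y) (b : β.B), x = v (q, b) →
      ∃ c, y = v (q, c) ∧ φ c ≤ φ b + W.length := by
    intro x y W
    induction W with
    | nil => intro b hb; exact ⟨b, hb, by simp⟩
    | @cons x z y hadj W ih =>
      intro b hb
      have hst : ∃ c, z = v (q, c) ∧ φ c ≤ φ b + 1 := by
        rw [hF, SimpleGraph.fromEdgeSet_adj] at hadj
        have hmem := hadj.1
        have hmem2 := hsub i hmem
        rw [hG] at hmem2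
        obtain ⟨(⟨q', b'⟩ | ⟨⟨q', b'⟩, j⟩), hi, he⟩ := hmem2
        · simp only [val, Set.mem_ofPred_eq] at hi
          obtain ⟨c', hc'⟩ := Option.ne_none_iff_exists'.1 hi
          simp only [ed, hc', Option.getD_some, Sym2.eq_iff] at he
          rcases he with ⟨h1, h2⟩ | ⟨h1, h2⟩
          · have := hv (h1.trans hb)
            simp only [Prod.mk.injEq] at this
            obtain ⟨rfl, rfl⟩ := this
            exact ⟨c', h2.symm, (hφ2 _ _ hc').2⟩
          · have := hv (h2.trans hb)
            simp only [Prod.mk.injEq] at this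
            obtain ⟨rfl, rfl⟩ := this
            exact ⟨b', h1.symm, (hφ2 _ _ hc').1⟩
        · exfalso
          have hz : b' = b ∧ q' = q := by
            simp only [ed, Sym2.eq_iff] at he
            rcases he with ⟨h1, h2⟩ | ⟨h1, h2⟩
            · have := hv (h1.trans hb)
              simp only [Prod.mk.injEq] at this
              exact ⟨this.2, this.1⟩
            · exact absurd (h2.trans hb).symm (hvr _ _)
          obtain ⟨rfl, rfl⟩ := hz
          rw [hupp, Finset.card_eq_zero, Finset.filter_eq_empty_iff] at hq0
          refine hq0 (x := (b', j)) (Finset.mem_univ _) ⟨hi, ?_⟩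
          rw [he]
          exact hmem
      obtain ⟨c, hc, hle⟩ := hst
      obtain ⟨c', hc', hle'⟩ := ih c hc
      refine ⟨c', hc', ?_⟩
      rw [SimpleGraph.Walk.length_cons]
      omega
  obtain ⟨W, hW⟩ := hR.exists_walk_length_eq_dist
  obtain ⟨c, hc, hle⟩ := key _ _ W s rfl
  have := hv hc
  simp only [Prod.mk.injEq, true_and] at this
  subst this
  have := hφ1 t ht (Ne.symm hst)
  omega

end

/-- The main counting argument: a block yields the graph. -/
lemma of_block {k dd : ℕ} {θ : ℝ} (β : Blk k dd θ) (hk : 1 ≤ k) (hθ : 0 ≤ θ) (D : ℕ) (ρ : ℝ)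
    (hρ : k + θ < ρ) :
    ∃ (n : ℕ) (G : SimpleGraph (Fin n)),
      (∀ H : G.Subgraph, 2 ≤ H.verts.ncard →
        (H.edgeSet.ncard : ℝ) / (H.verts.ncard - 1) < ρ) ∧
      ∀ P : Fin (k + 1) → Set (Sym2 (Fin n)), IsPseudoforestDecomp G (k + 1) P →
        ∀ i : Fin (k + 1),
          (∀ v : Fin n, {e | e ∈ P i ∧ v ∈ e}.ncard ≤ D) →
          ∃ (K : (SimpleGraph.fromEdgeSet (P i)).ConnectedComponent) (u v : Fin n),
            u ∈ K.supp ∧ v ∈ K.supp ∧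
              dd ≤ (SimpleGraph.fromEdgeSet (P i)).dist u v := by
  obtain ⟨Q, hQ⟩ : ∃ Q, D * k + k * k + Fintype.card β.B * (D * k) < Q := ⟨_, Nat.lt_succ_self _⟩
  let e := Fintype.equivFin ((Fin Q × β.B) ⊕ Fin k)
  let v : Fin Q × β.B → Fin (Fintype.card ((Fin Q × β.B) ⊕ Fin k)) := fun x => e (.inl x)
  let r : Fin k → Fin (Fintype.card ((Fin Q × β.B) ⊕ Fin k)) := fun x => e (.inr x)
  have hv : Function.Injective v := e.injective.comp Sum.inl_injective
  have hr : Function.Injective r := e.injective.comp Sum.inr_injective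
  have hvr : ∀ x j, v x ≠ r j := by
    intro x j h
    have := e.injective h
    simp at this
  refine ⟨_, gr β v r, fun H h2 => dens β v r hv hr hvr hk hθ ρ hρ H h2, ?_⟩
  intro P hP i hD
  exact diam β v r hv hr hvr D (by simp) hQ P hP i hD

/-- Counting inside one chain. -/
lemma chain_ineq (ℓ : ℕ) (θ δ : ℝ) (hθ : θ ≤ 1) (hδ : 0 ≤ δ) (hs : (ℓ + 1) * (1 - θ) + δ = 1)
    (χ : Fin (ℓ + 1) → ℝ) (hχ : ∀ h, χ h = 0 ∨ χ h = 1) :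
    ∑ h : Fin ℓ, χ h.succ * χ h.castSucc ≤ θ * ∑ h, χ h - δ * χ 0 := by
  have claim : ∀ j, ∑ h : Fin ℓ, χ h.succ * χ h.castSucc ≤ ∑ h, χ h - χ j := by
    intro j
    rw [Fin.sum_univ_succAbove χ j, add_sub_cancel_left]
    refine Finset.sum_le_sum fun h _ => ?_
    rcases lt_or_ge h.castSucc j with hlt | hge
    · rw [Fin.succAbove_of_castSucc_lt _ _ hlt]
      rcases hχ h.succ with h1 | h1 <;> rcases hχ h.castSucc with h2 | h2 <;> simp [h1, h2]
    · rw [Fin.succAbove_of_le_castSucc _ _ hge]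
      rcases hχ h.succ with h1 | h1 <;> rcases hχ h.castSucc with h2 | h2 <;> simp [h1, h2]
  have h1 := Finset.sum_le_sum fun j (_ : j ∈ Finset.univ) => claim j
  rw [Finset.sum_sub_distrib] at h1
  simp only [Finset.sum_const, Finset.card_univ, Fintype.card_fin, nsmul_eq_mul] at h1
  push_cast at h1
  have h2 := claim 0
  set A := ∑ h : Fin ℓ, χ h.succ * χ h.castSucc
  set C := ∑ h, χ h
  have h3 := mul_le_mul_of_nonneg_left h1 (sub_nonneg.2 hθ)
  have h4 := mul_le_mul_of_nonneg_left h2 hδ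
  have h5 : (1 - θ) * ((ℓ + 1) * A) + δ * A = A := by linear_combination A * hs
  have h6 : (1 - θ) * ((ℓ + 1) * C) + δ * C = C := by linear_combination C * hs
  nlinarith

/-- Spine counting. -/
lemma spine_ineq (δ : ℝ) (hδ0 : 0 ≤ δ) (hδ : δ ≤ 1) (y z : ℕ → ℝ) (hy : ∀ i, y i = 0 ∨ y i = 1)
    (hz : ∀ i, z i = 0 ∨ z i = 1) (n : ℕ) :
    ∃ a : ℝ, (a = 0 ∨ a = 1) ∧ (∀ i ≤ n, a ≤ y i) ∧
      ∑ i ∈ Finset.range n, (z i * (y i + y (i + 1) - 1 + δ) - y (i + 1) * (1 + δ) +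
        δ * (y (i + 1) - y i)) ≤ (1 - δ) * (a - y n) := by
  induction n with
  | zero => exact ⟨y 0, hy 0, by intro i hi; simp at hi; simp [hi], by simp⟩
  | succ n ih =>
    obtain ⟨a, ha, hay, hle⟩ := ih
    have han := hay n le_rfl
    refine ⟨a * z n * y (n + 1), ?_, ?_, ?_⟩
    · rcases ha with h | h <;> rcases hz n with h1 | h1 <;> rcases hy (n + 1) with h2 | h2 <;>
        simp [h, h1, h2]
    · intro i hi
      rcases Nat.lt_or_ge n i with h | h
      · obtain rfl : i = n + 1 := by omega
        rcases ha with h | h <;> rcases hz n with h1 | h1 <;> rcases hy (n + 1) with h2 | h2 <;>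
          simp [h, h1, h2]
      · refine le_trans ?_ (hay i h)
        rcases ha with h | h <;> rcases hz n with h1 | h1 <;> rcases hy (n + 1) with h2 | h2 <;>
          simp [h, h1, h2]
    · rw [Finset.sum_range_succ]
      rcases ha with h | h <;> rcases hz n with h1 | h1 <;> rcases hy (n + 1) with h2 | h2 <;>
        rcases hy n with h3 | h3 <;> simp only [h, h1, h2, h3] at hle han ⊢ <;> linarith

/-- Spine counting, second version. -/
lemma spine_ineq' (y : ℕ → ℝ) (hy : ∀ i, y i = 0 ∨ y i = 1) (n : ℕ) :
    ∃ a : ℝ, (a = 0 ∨ a = 1) ∧ (∀ i ≤ n, a ≤ y i) ∧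
      ∑ i ∈ Finset.range n, (y (i + 1) * (y i - 1)) ≤ a - y n := by
  obtain ⟨a, h1, h2, h3⟩ := spine_ineq 0 le_rfl zero_le_one y (fun i => y (i + 1)) hy (fun i => hy _) n
  rw [sub_zero, one_mul] at h3
  refine ⟨a, h1, h2, le_trans (Finset.sum_le_sum fun i _ => ?_) h3⟩
  rcases hy i with h | h <;> rcases hy (i + 1) with h' | h' <;> simp [h, h']

/-- Deficit of the spine vertices. -/
def sdf (n : ℕ) (i : Fin (n + 2)) : ℕ := if i = 0 ∨ i = Fin.last (n + 1) then 0 else 1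

lemma sdf_sum (n : ℕ) : ∑ i, sdf n i = n := by
  rw [Fin.sum_univ_succ, Fin.sum_univ_castSucc]
  simp [sdf]

lemma ext_fun {m : ℕ} (f : Fin m → ℝ) (hf : ∀ i, f i = 0 ∨ f i = 1) :
    ∃ y : ℕ → ℝ, (∀ i, y i = 0 ∨ y i = 1) ∧ ∀ i : Fin m, y i = f i := by
  refine ⟨fun i => if h : i < m then f ⟨i, h⟩ else 0, fun i => ?_, fun i => by simp⟩
  by_cases h : i < m
  · simpa [h] using hf ⟨i, h⟩
  · simp [h]

/-- Parent map of the first block. -/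
def par0 (n ℓ : ℕ) (b : Fin (n + 2) × Fin (ℓ + 1)) : Option (Fin (n + 2) × Fin (ℓ + 1)) :=
  Fin.cases (motive := fun _ => Option (Fin (n + 2) × Fin (ℓ + 1)))
    (Fin.cases (motive := fun _ => Option (Fin (n + 2) × Fin (ℓ + 1)))
      none (fun i => some (i.castSucc, 0)) b.1)
    (fun h => some (b.1, h.castSucc)) b.2

lemma par0_cases (n ℓ : ℕ) (R : Fin (n + 2) × Fin (ℓ + 1) → Fin (n + 2) × Fin (ℓ + 1) → Prop)
    (h1 : ∀ i h, R (i, Fin.succ h) (i, Fin.castSucc h)) (h2 : ∀ i, R (Fin.succ i, 0) (i.castSucc, 0)) :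
    ∀ b b', par0 n ℓ b = some b' → R b b' := by
  rintro ⟨i, h⟩ b' hb
  induction h using Fin.cases with
  | zero =>
    induction i using Fin.cases with
    | zero => simp [par0] at hb
    | succ i => simp [par0] at hb; subst hb; exact h2 i
  | succ h => simp [par0] at hb; subst hb; exact h1 i h

lemma blk0_dens (n ℓ : ℕ) (ε : ℝ) (hn : 1 ≤ ε * (n + 1))
    (χ : Fin (n + 2) × Fin (ℓ + 1) → ℝ) (hχ : ∀ b, χ b = 0 ∨ χ b = 1) :
    ∑ b, χ b * ((par0 n ℓ b).elim 0 χ - ((if b.2 = 0 then sdf n b.1 else 0 : ℕ) : ℝ)) ≤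
      ((ℓ : ℝ) / (ℓ + 1) + ε) * ∑ b, χ b := by
  have hℓ : (0 : ℝ) < ℓ + 1 := by positivity
  have hch : ∀ i, ∑ h : Fin ℓ, χ (i, h.succ) * χ (i, h.castSucc) ≤
      (ℓ : ℝ) / (ℓ + 1) * ∑ h, χ (i, h) := by
    intro i
    have := chain_ineq ℓ ((ℓ : ℝ) / (ℓ + 1)) 0 (by rw [div_le_one hℓ]; linarith) le_rfl
      (by field_simp; ring) (fun h => χ (i, h)) (fun h => hχ _)
    simpa using this
  obtain ⟨y, hy, hyχ⟩ := ext_fun (fun i => χ (i, 0)) (fun i => hχ _)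
  obtain ⟨a, ha, hay, hle⟩ := spine_ineq' y hy (n + 1)
  have hA : (n + 1) * a ≤ ∑ b, χ b := by
    calc (n + 1) * a ≤ (n + 2 : ℕ) * a := by push_cast; rcases ha with h | h <;> rw [h] <;> linarith
      _ = ∑ i : Fin (n + 2), a := by simp
      _ ≤ ∑ i : Fin (n + 2), χ (i, 0) := Finset.sum_le_sum fun i _ => by
          rw [← hyχ]; exact hay _ (by omega)
      _ ≤ ∑ i : Fin (n + 2), ∑ h, χ (i, h) := Finset.sum_le_sum fun i _ =>
          Finset.single_le_sum (f := fun h => χ (i, h))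
            (fun h _ => by rcases hχ (i, h) with h | h <;> simp [h]) (Finset.mem_univ 0)
      _ = _ := by rw [Fintype.sum_prod_type]
  have hE : a ≤ ε * ∑ b, χ b := by
    have hε : 0 ≤ ε := by
      by_contra h
      push Not at h
      nlinarith [(Nat.cast_nonneg n : (0 : ℝ) ≤ n)]
    have := mul_le_mul_of_nonneg_left hA hε
    rcases ha with h | h <;> rw [h] at this ⊢ <;> linarith
  have hsp : ∑ i : Fin (n + 2), χ (i, 0) * ((par0 n ℓ (i, 0)).elim 0 χ - (sdf n i : ℝ)) ≤ a := by
    rw [Fin.sum_univ_succ]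
    have h0 : (par0 n ℓ (0, 0)).elim 0 χ - (sdf n 0 : ℝ) = 0 := by simp [par0, sdf]
    rw [h0, mul_zero, zero_add]
    have h1 : ∀ i : Fin (n + 1), χ (i.succ, 0) * ((par0 n ℓ (i.succ, 0)).elim 0 χ - (sdf n i.succ : ℝ))
        = y (i + 1) * (y i - 1) + (if i = Fin.last n then y (n + 1) else 0) := by
      intro i
      have e1 : χ (i.succ, 0) = y (i + 1) := by rw [← hyχ]; simp
      have e2 : (par0 n ℓ (i.succ, 0)).elim 0 χ = y i := by
        have := hyχ i.castSucc
        simp [par0] at this ⊢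
        exact this.symm
      rw [e1, e2]
      by_cases hi : i = Fin.last n
      · subst hi
        simp [sdf]
        ring
      · have hi' : i.succ ≠ Fin.last (n + 1) := by
          rwa [← Fin.succ_last, Ne, Fin.succ_inj]
        simp [sdf, hi, hi', Fin.succ_ne_zero]
    rw [Finset.sum_congr rfl fun i _ => h1 i, Finset.sum_add_distrib,
      Fin.sum_univ_eq_sum_range (fun i => y (i + 1) * (y i - 1))]
    simp
    linarith
  have hsplit : ∑ b, χ b * ((par0 n ℓ b).elim 0 χ - ((if b.2 = 0 then sdf n b.1 else 0 : ℕ) : ℝ)) =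
      ∑ i : Fin (n + 2), χ (i, 0) * ((par0 n ℓ (i, 0)).elim 0 χ - (sdf n i : ℝ)) +
      ∑ i : Fin (n + 2), ∑ h : Fin ℓ, χ (i, h.succ) * χ (i, h.castSucc) := by
    rw [Fintype.sum_prod_type, ← Finset.sum_add_distrib]
    refine Finset.sum_congr rfl fun i _ => ?_
    rw [Fin.sum_univ_succ]
    congr 1
    refine Finset.sum_congr rfl fun h _ => ?_
    simp [par0, Fin.succ_ne_zero]
  have hch' := Finset.sum_le_sum fun i (_ : i ∈ Finset.univ) => hch i
  rw [← Finset.mul_sum, ← Fintype.sum_prod_type (f := χ)] at hch'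
  rw [hsplit, add_mul]
  linarith

/-- The block for `α = 0`. -/
noncomputable def blk0 (k ℓ n : ℕ) (hk : 1 ≤ k) (ε : ℝ) (hn : 1 ≤ ε * (n + 1)) :
    Blk k (2 * ℓ + 1) ((ℓ : ℝ) / (ℓ + 1) + ε) where
  B := Fin (n + 2) × Fin (ℓ + 1)
  fin := inferInstance
  dec := inferInstance
  p := par0 n ℓ
  rank := fun b => b.1 + b.2
  hrank := par0_cases n ℓ (fun b b' => (b'.1 + b'.2 : ℕ) < b.1 + b.2) (by simp) (by simp)
  root := (0, 0)
  hroot := by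
    rintro ⟨i, h⟩ hb
    induction h using Fin.cases with
    | zero =>
      induction i using Fin.cases with
      | zero => rfl
      | succ i => simp [par0] at hb
    | succ h => simp [par0] at hb
  df := fun b => if b.2 = 0 then sdf n b.1 else 0
  hdf := by
    intro b
    simp only [sdf]
    split_ifs <;> omega
  S := Finset.univ.image fun i => (i, Fin.last ℓ)
  hS := by
    rw [Finset.card_image_of_injective _ (fun a b h => (Prod.mk.inj h).1), Fintype.sum_prod_type]
    simp [sdf_sum]
  hpot := by
    intro s hs
    simp only [Finset.mem_image, Finset.mem_univ, true_and] at hs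
    obtain ⟨i₀, rfl⟩ := hs
    refine ⟨fun b => if b.1 = i₀ then ℓ - b.2 else ℓ + 1 + b.2, by simp, ?_, ?_⟩
    · intro t ht hne
      simp only [Finset.mem_image, Finset.mem_univ, true_and] at ht
      obtain ⟨i, rfl⟩ := ht
      have : i ≠ i₀ := by rintro rfl; exact hne rfl
      simp [this]
      omega
    · refine par0_cases n ℓ _ ?_ ?_
      · intro i h
        simp only [Fin.val_succ, Fin.val_castSucc]
        split_ifs <;> omega
      · intro i
        simp only [Fin.val_zero]
        split_ifs <;> omega
  hdens := blk0_dens n ℓ ε hn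

/-- The vertex type of the second block. -/
abbrev B1 (k ℓ n : ℕ) :=
  (Fin (n + 2) × Fin (ℓ + 1)) ⊕ (((Fin (n + 1) × Fin k) × Fin (ℓ + 1)) ⊕ Fin (n + 1))

/-- Parent map of the second block. -/
def par1 (k ℓ n : ℕ) : B1 k ℓ n → Option (B1 k ℓ n)
  | .inl b => Fin.cases (motive := fun _ => Option (B1 k ℓ n))
    (Fin.cases (motive := fun _ => Option (B1 k ℓ n))
      none (fun i => some (.inr (.inr i))) b.1)
    (fun h => some (.inl (b.1, h.castSucc))) b.2
  | .inr (.inl b) => Fin.cases (motive := fun _ => Option (B1 k ℓ n))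
    (some (.inr (.inr b.1.1)))
    (fun h => some (.inr (.inl (b.1, h.castSucc)))) b.2
  | .inr (.inr i) => some (.inl (i.castSucc, 0))

lemma par1_cases (k ℓ n : ℕ) (R : B1 k ℓ n → B1 k ℓ n → Prop)
    (h1 : ∀ i h, R (.inl (i, Fin.succ h)) (.inl (i, Fin.castSucc h)))
    (h2 : ∀ i, R (.inl (Fin.succ i, 0)) (.inr (.inr i)))
    (h3 : ∀ c h, R (.inr (.inl (c, Fin.succ h))) (.inr (.inl (c, Fin.castSucc h))))
    (h4 : ∀ c : Fin (n + 1) × Fin k, R (.inr (.inl (c, 0))) (.inr (.inr c.1)))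
    (h5 : ∀ i : Fin (n + 1), R (.inr (.inr i)) (.inl (i.castSucc, 0))) :
    ∀ b b', par1 k ℓ n b = some b' → R b b' := by
  rintro (⟨i, h⟩ | ⟨c, h⟩ | i) b' hb
  · induction h using Fin.cases with
    | zero =>
      induction i using Fin.cases with
      | zero => simp [par1] at hb
      | succ i => simp [par1] at hb; subst hb; exact h2 i
    | succ h => simp [par1] at hb; subst hb; exact h1 i h
  · induction h using Fin.cases with
    | zero => simp [par1] at hb; subst hb; exact h4 c
    | succ h => simp [par1] at hb; subst hb; exact h3 c h
  · simp [par1] at hb; subst hb; exact h5 i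

/-- Deficits of the second block. -/
def df1 (k ℓ n : ℕ) : B1 k ℓ n → ℕ
  | .inl b => if b.2 = 0 then sdf n b.1 else 0
  | .inr (.inl _) => 0
  | .inr (.inr _) => k

/-- Potential on the second block, relative to a spine chain. -/
def potA (k ℓ n : ℕ) (i₀ : Fin (n + 2)) : B1 k ℓ n → ℕ
  | .inl b => if b.1 = i₀ then ℓ - b.2 else ℓ + 2 + b.2
  | .inr (.inl b) => ℓ + 2 + b.2
  | .inr (.inr _) => ℓ + 1

/-- Potential on the second block, relative to a pendant chain. -/
def potB (k ℓ n : ℕ) (c₀ : Fin (n + 1) × Fin k) : B1 k ℓ n → ℕ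
  | .inl b => ℓ + 2 + b.2
  | .inr (.inl b) => if b.1 = c₀ then ℓ - b.2 else ℓ + 2 + b.2
  | .inr (.inr _) => ℓ + 1

/-- Rank on the second block. -/
def rank1 (k ℓ n : ℕ) : B1 k ℓ n → ℕ
  | .inl b => 2 * b.1 + b.2
  | .inr (.inl b) => 2 * b.1.1 + 2 + b.2
  | .inr (.inr i) => 2 * i + 1

/-- The tips of the chains of the second block. -/
def tip1 (k ℓ n : ℕ) : Fin (n + 2) ⊕ (Fin (n + 1) × Fin k) → B1 k ℓ n
  | .inl i => .inl (i, Fin.last ℓ)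
  | .inr c => .inr (.inl (c, Fin.last ℓ))

lemma tip1_inj (k ℓ n : ℕ) : Function.Injective (tip1 k ℓ n) := by
  rintro (i | c) (j | d) h <;> simp [tip1] at h ⊢ <;> exact h

lemma blk1_dens (k ℓ n : ℕ) (ε : ℝ) (hn : 1 ≤ ε * (n + 1))
    (χ : B1 k ℓ n → ℝ) (hχ : ∀ b, χ b = 0 ∨ χ b = 1) :
    ∑ b, χ b * ((par1 k ℓ n b).elim 0 χ - (df1 k ℓ n b : ℝ)) ≤
      (((ℓ : ℝ) * (k + 1) + 1) / ((ℓ + 1) * (k + 1) + 1) + ε) * ∑ b, χ b := by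
  have hden : (0 : ℝ) < (ℓ + 1) * (k + 1) + 1 := by positivity
  obtain ⟨θ, hθ⟩ : ∃ θ, θ = ((ℓ : ℝ) * (k + 1) + 1) / ((ℓ + 1) * (k + 1) + 1) := ⟨_, rfl⟩
  obtain ⟨δ, hδ⟩ : ∃ δ, δ = 1 / (((ℓ : ℝ) + 1) * (k + 1) + 1) := ⟨_, rfl⟩
  rw [← hθ]
  have hδ0 : 0 ≤ δ := by rw [hδ]; positivity
  have hδ1 : δ ≤ 1 := by
    rw [hδ, div_le_one hden]
    have : (0 : ℝ) ≤ (ℓ + 1) * (k + 1) := by positivity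
    linarith
  have hrel : k * δ + θ = 1 - δ := by
    rw [hδ, hθ]; field_simp; ring
  have hsum1 : (ℓ + 1) * (1 - θ) + δ = 1 := by
    rw [hδ, hθ]; field_simp; ring
  have hθ1 : θ ≤ 1 := by
    have : 0 ≤ (k : ℝ) * δ := by positivity
    linarith
  have hχ0 : ∀ b, 0 ≤ χ b := fun b => by rcases hχ b with h | h <;> simp [h]
  have hχ1 : ∀ b, χ b ≤ 1 := fun b => by rcases hχ b with h | h <;> simp [h]
  obtain ⟨y, hy, hyχ⟩ := ext_fun (fun i => χ (.inl (i, 0))) (fun i => hχ _)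
  obtain ⟨z, hz, hzχ⟩ := ext_fun (fun i => χ (.inr (.inr i))) (fun i => hχ _)
  obtain ⟨a, ha, hay, hle⟩ := spine_ineq δ hδ0 hδ1 y z hy hz (n + 1)
  have hT : ∑ b, χ b = ∑ i, ∑ h, χ (.inl (i, h)) +
      (∑ c, ∑ h, χ (.inr (.inl (c, h))) + ∑ i ∈ Finset.range (n + 1), z i) := by
    rw [Fintype.sum_sum_type, Fintype.sum_sum_type, Fintype.sum_prod_type,
      Fintype.sum_prod_type (f := fun x => χ (.inr (.inl x))), ← Fin.sum_univ_eq_sum_range]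
    simp only [hzχ]
  have hE : a ≤ ε * ∑ b, χ b := by
    have hA : (n + 1) * a ≤ ∑ b, χ b := by
      calc (n + 1) * a ≤ (n + 2 : ℕ) * a := by
            push_cast; rcases ha with h | h <;> rw [h] <;> linarith
        _ = ∑ i : Fin (n + 2), a := by simp
        _ ≤ ∑ i : Fin (n + 2), χ (.inl (i, 0)) := Finset.sum_le_sum fun i _ => by
            rw [← hyχ]; exact hay _ (by omega)
        _ ≤ ∑ i : Fin (n + 2), ∑ h, χ (.inl (i, h)) := Finset.sum_le_sum fun i _ =>
            Finset.single_le_sum (f := fun h => χ (.inl (i, h)))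
              (fun h _ => hχ0 _) (Finset.mem_univ 0)
        _ ≤ _ := by
            rw [Fintype.sum_sum_type, Fintype.sum_prod_type]
            exact le_add_of_nonneg_right (Finset.sum_nonneg fun b _ => hχ0 _)
    have hε : 0 ≤ ε := by
      by_contra h
      push Not at h
      nlinarith [(Nat.cast_nonneg n : (0 : ℝ) ≤ n)]
    have := mul_le_mul_of_nonneg_left hA hε
    rcases ha with h | h <;> rw [h] at this ⊢ <;> linarith
  -- spine chains
  have s1 : ∑ b : Fin (n + 2) × Fin (ℓ + 1), χ (.inl b) * ((par1 k ℓ n (.inl b)).elim 0 χ -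
      (df1 k ℓ n (.inl b) : ℝ)) ≤ ∑ i ∈ Finset.range (n + 1), (y (i + 1) * (z i - 1 - δ)) +
        y (n + 1) - δ * y 0 + θ * ∑ i, ∑ h, χ (.inl (i, h)) := by
    have hsplit : ∑ b : Fin (n + 2) × Fin (ℓ + 1), χ (.inl b) * ((par1 k ℓ n (.inl b)).elim 0 χ -
        (df1 k ℓ n (.inl b) : ℝ)) =
        ∑ i : Fin (n + 2), χ (.inl (i, 0)) * ((par1 k ℓ n (.inl (i, 0))).elim 0 χ - (sdf n i : ℝ)) +
        ∑ i : Fin (n + 2), ∑ h : Fin ℓ, χ (.inl (i, h.succ)) * χ (.inl (i, h.castSucc)) := by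
      rw [Fintype.sum_prod_type, ← Finset.sum_add_distrib]
      refine Finset.sum_congr rfl fun i _ => ?_
      rw [Fin.sum_univ_succ]
      congr 1
      refine Finset.sum_congr rfl fun h _ => ?_
      simp [par1, df1, Fin.succ_ne_zero]
    have hch : ∀ i, ∑ h : Fin ℓ, χ (.inl (i, h.succ)) * χ (.inl (i, h.castSucc)) ≤
        θ * ∑ h, χ (.inl (i, h)) - δ * χ (.inl (i, 0)) := fun i =>
      chain_ineq ℓ θ δ hθ1 hδ0 hsum1 (fun h => χ (.inl (i, h))) (fun h => hχ _)
    have hch' := Finset.sum_le_sum fun i (_ : i ∈ Finset.univ) => hch i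
    rw [Finset.sum_sub_distrib, ← Finset.mul_sum, ← Finset.mul_sum] at hch'
    have hY : ∑ i : Fin (n + 2), χ (.inl (i, 0)) = y 0 + ∑ i ∈ Finset.range (n + 1), y (i + 1) := by
      rw [← Finset.sum_congr rfl fun i _ => hyχ i, Fin.sum_univ_eq_sum_range (fun i => y i),
        Finset.sum_range_succ', add_comm]
    have hsp : ∑ i : Fin (n + 2), χ (.inl (i, 0)) * ((par1 k ℓ n (.inl (i, 0))).elim 0 χ -
        (sdf n i : ℝ)) = ∑ i ∈ Finset.range (n + 1), (y (i + 1) * (z i - 1)) + y (n + 1) := by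
      rw [Fin.sum_univ_succ]
      have h0 : (par1 k ℓ n (.inl (0, 0))).elim 0 χ - (sdf n 0 : ℝ) = 0 := by simp [par1, sdf]
      rw [h0, mul_zero, zero_add]
      have h1 : ∀ i : Fin (n + 1), χ (.inl (i.succ, 0)) *
          ((par1 k ℓ n (.inl (i.succ, 0))).elim 0 χ - (sdf n i.succ : ℝ))
          = y (i + 1) * (z i - 1) + (if i = Fin.last n then y (n + 1) else 0) := by
        intro i
        have e1 : χ (.inl (i.succ, 0)) = y (i + 1) := by rw [← hyχ]; simp
        have e2 : (par1 k ℓ n (.inl (i.succ, 0))).elim 0 χ = z i := by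
          rw [hzχ]; simp [par1]
        rw [e1, e2]
        by_cases hi : i = Fin.last n
        · subst hi
          simp [sdf]
          ring
        · have hi' : i.succ ≠ Fin.last (n + 1) := by
            rwa [← Fin.succ_last, Ne, Fin.succ_inj]
          simp [sdf, hi, hi', Fin.succ_ne_zero]
      rw [Finset.sum_congr rfl fun i _ => h1 i, Finset.sum_add_distrib,
        Fin.sum_univ_eq_sum_range (fun i => y (i + 1) * (z i - 1))]
      simp
    have hd : ∑ i ∈ Finset.range (n + 1), (y (i + 1) * (z i - 1 - δ)) =
        ∑ i ∈ Finset.range (n + 1), (y (i + 1) * (z i - 1)) -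
          δ * ∑ i ∈ Finset.range (n + 1), y (i + 1) := by
      rw [Finset.mul_sum, ← Finset.sum_sub_distrib]
      exact Finset.sum_congr rfl fun i _ => by ring
    rw [hsplit, hsp, hd]
    rw [hY] at hch'
    linarith
  -- pendant chains
  have s2 : ∑ b : (Fin (n + 1) × Fin k) × Fin (ℓ + 1), χ (.inr (.inl b)) *
      ((par1 k ℓ n (.inr (.inl b))).elim 0 χ - (df1 k ℓ n (.inr (.inl b)) : ℝ)) ≤
      ∑ i ∈ Finset.range (n + 1), (z i * (k * (1 - δ))) +
        θ * ∑ c, ∑ h, χ (.inr (.inl (c, h))) := by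
    have hc : ∀ c : Fin (n + 1) × Fin k, ∑ h : Fin (ℓ + 1), χ (.inr (.inl (c, h))) *
        ((par1 k ℓ n (.inr (.inl (c, h)))).elim 0 χ - (df1 k ℓ n (.inr (.inl (c, h))) : ℝ)) ≤
        z c.1 * (1 - δ) + θ * ∑ h, χ (.inr (.inl (c, h))) := by
      intro c
      have hch := chain_ineq ℓ θ δ hθ1 hδ0 hsum1 (fun h => χ (.inr (.inl (c, h)))) (fun h => hχ _)
      rw [Fin.sum_univ_succ]
      have e1 : ∀ h : Fin ℓ, χ (.inr (.inl (c, h.succ))) *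
        ((par1 k ℓ n (.inr (.inl (c, h.succ)))).elim 0 χ -
          (df1 k ℓ n (.inr (.inl (c, h.succ))) : ℝ)) =
          χ (.inr (.inl (c, h.succ))) * χ (.inr (.inl (c, h.castSucc))) := by
        intro h
        simp [par1, df1]
      have e2 : (par1 k ℓ n (.inr (.inl (c, 0)))).elim 0 χ -
          (df1 k ℓ n (.inr (.inl (c, 0))) : ℝ) = z c.1 := by
        rw [hzχ]; simp [par1, df1]
      rw [Finset.sum_congr rfl fun h _ => e1 h, e2]
      have e3 : χ (.inr (.inl (c, 0))) * (z c.1 - δ) ≤ z c.1 * (1 - δ) := by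
        rcases hχ (.inr (.inl (c, 0))) with h | h <;> rcases hz c.1 with h' | h' <;>
          rw [h, h'] <;> linarith
      linarith
    rw [Fintype.sum_prod_type]
    refine (Finset.sum_le_sum fun c _ => hc c).trans (le_of_eq ?_)
    rw [Finset.sum_add_distrib, ← Finset.mul_sum, Fintype.sum_prod_type,
      ← Fin.sum_univ_eq_sum_range (fun i => z i * (k * (1 - δ)))]
    congr 1
    refine Finset.sum_congr rfl fun i _ => ?_
    simp
    ring
  have s3 : ∑ i : Fin (n + 1), χ (.inr (.inr i)) *
      ((par1 k ℓ n (.inr (.inr i))).elim 0 χ - (df1 k ℓ n (.inr (.inr i)) : ℝ)) =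
      ∑ i ∈ Finset.range (n + 1), (z i * (y i - k)) := by
    rw [← Fin.sum_univ_eq_sum_range (fun i => z i * (y i - k))]
    refine Finset.sum_congr rfl fun i _ => ?_
    have := hyχ i.castSucc
    simp only [Fin.val_castSucc] at this
    rw [hzχ, this]
    simp [par1, df1]
  have s4 : ∑ i ∈ Finset.range (n + 1), (z i * (y i + y (i + 1) - 1 + δ) - y (i + 1) * (1 + δ) +
        δ * (y (i + 1) - y i)) =
      ∑ i ∈ Finset.range (n + 1), (y (i + 1) * (z i - 1 - δ)) +
      ∑ i ∈ Finset.range (n + 1), (z i * (k * (1 - δ))) +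
      ∑ i ∈ Finset.range (n + 1), (z i * (y i - k)) -
      θ * ∑ i ∈ Finset.range (n + 1), z i + δ * (y (n + 1) - y 0) := by
    rw [← Finset.sum_range_sub, Finset.mul_sum, Finset.mul_sum, ← Finset.sum_add_distrib,
      ← Finset.sum_add_distrib, ← Finset.sum_sub_distrib, ← Finset.sum_add_distrib]
    refine Finset.sum_congr rfl fun i _ => ?_
    linear_combination (z i) * hrel
  rw [Fintype.sum_sum_type, Fintype.sum_sum_type, s3, add_mul, hT]
  rw [hT] at hE
  rw [s4] at hle
  have ha0 : 0 ≤ a := by rcases ha with h | h <;> simp [h]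
  have : (1 - δ) * a ≤ a := by nlinarith
  linarith

/-- The block for `α = 1`. -/
noncomputable def blk1 (k ℓ n : ℕ) (hk : 1 ≤ k) (ε : ℝ) (hn : 1 ≤ ε * (n + 1)) :
    Blk k (2 * ℓ + 2) (((ℓ : ℝ) * (k + 1) + 1) / ((ℓ + 1) * (k + 1) + 1) + ε) where
  B := B1 k ℓ n
  fin := inferInstance
  dec := inferInstance
  p := par1 k ℓ n
  rank := rank1 k ℓ n
  hrank := by
    refine par1_cases k ℓ n (fun b b' => rank1 k ℓ n b' < rank1 k ℓ n b) ?_ ?_ ?_ ?_ ?_ <;>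
      intros <;> simp [rank1] <;> omega
  root := .inl (0, 0)
  hroot := by
    rintro (⟨i, h⟩ | ⟨c, h⟩ | i) hb
    · induction h using Fin.cases with
      | zero =>
        induction i using Fin.cases with
        | zero => rfl
        | succ i => simp [par1] at hb
      | succ h => simp [par1] at hb
    · induction h using Fin.cases with
      | zero => simp [par1] at hb
      | succ h => simp [par1] at hb
    · simp [par1] at hb
  df := df1 k ℓ n
  hdf := by
    rintro (⟨i, h⟩ | ⟨c, h⟩ | i) <;> simp only [df1, sdf] <;> try split_ifs
    all_goals omega
  S := Finset.univ.image (tip1 k ℓ n)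
  hS := by
    rw [Finset.card_image_of_injective _ (tip1_inj k ℓ n), Fintype.sum_sum_type,
      Fintype.sum_sum_type, Fintype.sum_prod_type]
    simp [df1, sdf_sum]
    ring
  hpot := by
    intro s hs
    simp only [Finset.mem_image, Finset.mem_univ, true_and] at hs
    obtain ⟨(i₀ | c₀), rfl⟩ := hs
    · refine ⟨potA k ℓ n i₀, by simp [potA, tip1], ?_, ?_⟩
      · intro t ht hne
        simp only [Finset.mem_image, Finset.mem_univ, true_and] at ht
        obtain ⟨(i | c), rfl⟩ := ht
        · have : i ≠ i₀ := by rintro rfl; exact hne rfl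
          simp [this, potA, tip1]
          omega
        · simp [potA, tip1]
          omega
      · refine par1_cases k ℓ n _ ?_ ?_ ?_ ?_ ?_ <;> intros <;>
          simp only [potA, Fin.val_succ, Fin.val_castSucc, Fin.val_zero] <;> try split_ifs
        all_goals omega
    · refine ⟨potB k ℓ n c₀, by simp [potB, tip1], ?_, ?_⟩
      · intro t ht hne
        simp only [Finset.mem_image, Finset.mem_univ, true_and] at ht
        obtain ⟨(i | c), rfl⟩ := ht
        · simp [potB, tip1]
          omega
        · have : c ≠ c₀ := by rintro rfl; exact hne rfl
          simp [this, potB, tip1]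
          omega
      · refine par1_cases k ℓ n _ ?_ ?_ ?_ ?_ ?_ <;> intros <;>
          simp only [potB, Fin.val_succ, Fin.val_castSucc, Fin.val_zero] <;> try split_ifs
        all_goals omega
  hdens := blk1_dens k ℓ n ε hn

theorem lower_bound_overall_diameter
    (k ℓ D : ℕ) (hk : 1 ≤ k) (α : ℕ) (hα : α = 0 ∨ α = 1) (ε : ℝ) (hε : 0 < ε) :
    ∃ (n : ℕ) (G : SimpleGraph (Fin n)),
      (∀ H : G.Subgraph, 2 ≤ H.verts.ncard →
        (H.edgeSet.ncard : ℝ) / (H.verts.ncard - 1) <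
          (k : ℝ) + ((ℓ : ℝ) * (k + 1) + α) / ((ℓ + 1) * (k + 1) + α) + ε) ∧
      ∀ P : Fin (k + 1) → Set (Sym2 (Fin n)), IsPseudoforestDecomp G (k + 1) P →
        ∀ i : Fin (k + 1),
          (∀ v : Fin n, {e | e ∈ P i ∧ v ∈ e}.ncard ≤ D) →
          ∃ (K : (SimpleGraph.fromEdgeSet (P i)).ConnectedComponent) (u v : Fin n),
            u ∈ K.supp ∧ v ∈ K.supp ∧
              2 * ℓ + 1 + α ≤ (SimpleGraph.fromEdgeSet (P i)).dist u v := by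
  obtain ⟨n, hn⟩ : ∃ n : ℕ, 1 ≤ ε / 2 * (n + 1) := by
    obtain ⟨n, hn⟩ := exists_nat_gt (2 / ε)
    refine ⟨n, ?_⟩
    rw [div_lt_iff₀ hε] at hn
    nlinarith
  rcases hα with rfl | rfl
  · refine of_block (blk0 k ℓ n hk (ε / 2) hn) hk (by positivity) D _ ?_
    have : ((ℓ : ℝ) * (k + 1) + (0 : ℕ)) / ((ℓ + 1) * (k + 1) + (0 : ℕ)) = (ℓ : ℝ) / (ℓ + 1) := by
      push_cast
      field_simp
      ring
    rw [this]
    linarith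
  · refine of_block (blk1 k ℓ n hk (ε / 2) hn) hk (by positivity) D _ ?_
    push_cast
    linarith
end

section
/- Let k ≥ 2, D ≥ 0, d ≥ 1, z ≥ 0 be integers with z ≤ ⌊(d-1)/(k+1)⌋, and let ε > 0 be a real number. There exists a finite simple graph G with fractional arboricity γ(G) < k + d/(d+k+1) + ε such that in every partition of the edge set of G into k+1 parts each spanning a pseudoforest, if one of the parts F has maximum degree at most D, then F has a connected component K with at least d − z(k−1) + 1 edges and with diameter at least 2(z+1). -/
open SimpleGraph

/-! ### General graph lemmas -/

/-- A function that changes by at most one along edges bounds the distance from below. -/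
lemma lip_walk {V : Type*} {H : SimpleGraph V} (g : V → ℤ)
    (hg : ∀ x y, H.Adj x y → g x - g y ≤ 1) {u v : V} (p : H.Walk u v) :
    g u - g v ≤ p.length := by
  induction p with
  | nil => simp
  | cons h p ih =>
    have := hg _ _ h
    simp only [Walk.length_cons]
    push_cast
    linarith

lemma lip_dist {V : Type*} {H : SimpleGraph V} (g : V → ℤ)
    (hg : ∀ x y, H.Adj x y → g x - g y ≤ 1) {u v : V} (hr : H.Reachable u v) :
    g u - g v ≤ H.dist u v := by
  obtain ⟨p, hp⟩ := hr.exists_walk_length_eq_dist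
  rw [← hp]
  exact lip_walk g hg p

/-- For a nonempty vertex set `U`, every vertex outside `U` which can reach `U` picks
an edge leading towards `U`; the number of those vertices is bounded by the edges used. -/
lemma exists_toward {V : Type*} [Finite V] (H : SimpleGraph V) (U : Set V) :
    ∃ par : V → V, ∀ x, x ∉ U → (∃ u ∈ U, H.Reachable x u) →
      H.Adj x (par x) ∧
        ∀ y, y ∉ U → (∃ u ∈ U, H.Reachable y u) → s(x, par x) = s(y, par y) → x = y := by
  classical
  let δ : V → ℕ := fun x => sInf {n | ∃ u ∈ U, ∃ p : H.Walk x u, p.length = n}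
  have key : ∀ x, ∃ y, x ∉ U → (∃ u ∈ U, H.Reachable x u) → H.Adj x y ∧ δ y < δ x := by
    intro x
    by_cases hx : x ∉ U ∧ (∃ u ∈ U, H.Reachable x u)
    · obtain ⟨hxU, u, hu, ⟨p⟩⟩ := hx
      have hne : {n | ∃ u ∈ U, ∃ p : H.Walk x u, p.length = n}.Nonempty :=
        ⟨p.length, u, hu, p, rfl⟩
      obtain ⟨u', hu', q, hq⟩ := Nat.sInf_mem hne
      cases q with
      | nil => exact absurd hu' hxU
      | cons h q =>
        rename_i y
        refine ⟨y, fun _ _ => ⟨h, ?_⟩⟩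
        have h1 : δ y ≤ q.length := Nat.sInf_le ⟨u', hu', q, rfl⟩
        have h2 : q.length + 1 = δ x := by simpa using hq
        omega
    · exact ⟨x, fun h1 h2 => absurd ⟨h1, h2⟩ hx⟩
  choose par hpar using key
  refine ⟨par, fun x hx hxu => ⟨(hpar x hx hxu).1, fun y hy hyu hxy => ?_⟩⟩
  have h1 := (hpar x hx hxu).2
  have h2 := (hpar y hy hyu).2
  rw [Sym2.eq_iff] at hxy
  rcases hxy with h | h
  · exact h.1
  · rw [h.2] at h1
    rw [← h.1] at h2
    omega

/-- Component edge count from below. -/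
lemma compEdges_ge {V : Type*} [Finite V] (H : SimpleGraph V) (w : V) (A : Finset V)
    (hA : ∀ x ∈ A, H.Reachable w x) (N : ℕ) (hN : N + 1 ≤ A.card) :
    N ≤ (compEdges H (H.connectedComponentMk w)).ncard := by
  classical
  obtain ⟨par, hpar⟩ := exists_toward H {w}
  have h1 : (↑(A.erase w) : Set V).ncard ≤
      (compEdges H (H.connectedComponentMk w)).ncard := by
    refine Set.ncard_le_ncard_of_injOn (fun x => s(x, par x)) ?_ ?_ (Set.toFinite _)
    · intro x hx
      have hx' := Finset.mem_erase.1 (Finset.mem_coe.1 hx)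
      have hr := hA x hx'.2
      have ha := (hpar x hx'.1 ⟨w, rfl, hr.symm⟩).1
      refine ⟨ha, ?_⟩
      intro v hv
      rw [Sym2.mem_iff] at hv
      rw [ConnectedComponent.mem_supp_iff, ConnectedComponent.eq]
      rcases hv with rfl | rfl
      · exact hr.symm
      · exact (hr.trans ha.reachable).symm
    · intro x hx y hy hxy
      have hx' := Finset.mem_erase.1 (Finset.mem_coe.1 hx)
      have hy' := Finset.mem_erase.1 (Finset.mem_coe.1 hy)
      exact (hpar x hx'.1 ⟨w, rfl, (hA x hx'.2).symm⟩).2 y hy'.1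
        ⟨w, rfl, (hA y hy'.2).symm⟩ hxy
  rw [Set.ncard_coe_finset] at h1
  have := Finset.pred_card_le_card_erase (s := A) (a := w)
  omega

/-- A pseudoforest has an orientation with outdegrees at most one. -/
lemma pseudoforest_orient {V : Type*} [Finite V] (H : SimpleGraph V) (hH : IsPseudoforest H) :
    ∃ f : H.edgeSet → V, Function.Injective f ∧ ∀ e : H.edgeSet, f e ∈ (e : Sym2 V) := by
  classical
  have := Fintype.ofFinite V
  have := (Finset.all_card_le_biUnion_card_iff_exists_injective
    (fun e : H.edgeSet => (e : Sym2 V).toFinset)).1 ?_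
  · obtain ⟨f, hf, hm⟩ := this
    exact ⟨f, hf, fun e => by simpa using hm e⟩
  intro A
  set U : Finset V := A.biUnion (fun e : H.edgeSet => (e : Sym2 V).toFinset) with hU
  obtain ⟨par, hpar⟩ := exists_toward H (U : Set V)
  -- components meeting `U`
  let CC : Finset H.ConnectedComponent := U.image H.connectedComponentMk
  let VM : Finset V := Finset.univ.filter (fun x => H.connectedComponentMk x ∈ CC)
  have hreach : ∀ x, x ∈ VM → ∃ u ∈ (U : Set V), H.Reachable x u := by
    intro x hx
    have := (Finset.mem_filter.1 hx).2
    obtain ⟨u, hu, he⟩ := Finset.mem_image.1 this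
    exact ⟨u, hu, (ConnectedComponent.eq.1 he).symm⟩
  have hUV : U ⊆ VM := fun u hu =>
    Finset.mem_filter.2 ⟨Finset.mem_univ _, Finset.mem_image_of_mem _ hu⟩
  let EM : Finset (Sym2 V) := CC.biUnion (fun c => (compEdges H c).toFinset)
  have hEM : EM.card ≤ VM.card := by
    have h1 : EM.card ≤ ∑ c ∈ CC, (compEdges H c).toFinset.card := Finset.card_biUnion_le
    have h2 : ∑ c ∈ CC, (compEdges H c).toFinset.card ≤ ∑ c ∈ CC, c.supp.toFinset.card := by
      refine Finset.sum_le_sum fun c _ => ?_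
      have := hH c
      rwa [Set.ncard_eq_toFinset_card', Set.ncard_eq_toFinset_card'] at this
    have h3 : VM.card = ∑ c ∈ CC, c.supp.toFinset.card := by
      rw [Finset.card_eq_sum_card_fiberwise (f := H.connectedComponentMk) (t := CC)]
      · refine Finset.sum_congr rfl fun c hc => ?_
        congr 1
        ext x
        simp only [VM, Finset.mem_filter, Finset.mem_univ, true_and, Set.mem_toFinset,
          ConnectedComponent.mem_supp_iff]
        constructor
        · exact fun h => h.2
        · exact fun h => ⟨h ▸ hc, h⟩
      · intro x hx
        exact (Finset.mem_filter.1 hx).2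
    omega
  -- edges of `A` and edges towards `U`
  let A' : Finset (Sym2 V) := A.map (Function.Embedding.subtype _)
  let B' : Finset (Sym2 V) := (VM \ U).image (fun x => s(x, par x))
  have hB : B'.card = (VM \ U).card := by
    refine Finset.card_image_of_injOn ?_
    intro x hx y hy hxy
    have hx' := Finset.mem_sdiff.1 (Finset.mem_coe.1 hx)
    have hy' := Finset.mem_sdiff.1 (Finset.mem_coe.1 hy)
    exact (hpar x (by simpa using hx'.2) (hreach x hx'.1)).2 y (by simpa using hy'.2)
      (hreach y hy'.1) hxy
  have hmemU : ∀ e ∈ A', ∀ v ∈ e, v ∈ U := by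
    intro e he v hv
    obtain ⟨e', he', rfl⟩ := Finset.mem_map.1 he
    exact Finset.mem_biUnion.2 ⟨e', he', by simpa using hv⟩
  have hdisj : Disjoint A' B' := by
    rw [Finset.disjoint_left]
    intro e heA heB
    obtain ⟨x, hx, rfl⟩ := Finset.mem_image.1 heB
    exact (Finset.mem_sdiff.1 hx).2 (hmemU _ heA x (Sym2.mem_mk_left _ _))
  have hsub : A' ∪ B' ⊆ EM := by
    intro e he
    rcases Finset.mem_union.1 he with h | h
    · have hmem := hmemU e h
      obtain ⟨e', he', rfl⟩ := Finset.mem_map.1 h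
      obtain ⟨e, hE⟩ := e'
      induction e using Sym2.ind with
      | _ a b =>
      have hab : H.Adj a b := hE
      refine Finset.mem_biUnion.2 ⟨H.connectedComponentMk a,
        Finset.mem_image_of_mem _ (hmem a (Sym2.mem_mk_left _ _)), ?_⟩
      rw [Set.mem_toFinset]
      refine ⟨hE, ?_⟩
      intro v hv
      rw [ConnectedComponent.mem_supp_iff, ConnectedComponent.eq]
      rcases Sym2.mem_iff.1 hv with rfl | rfl
      · exact Reachable.refl _
      · exact hab.reachable.symm
    · obtain ⟨x, hx, rfl⟩ := Finset.mem_image.1 h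
      have hx' := Finset.mem_sdiff.1 hx
      have ha := (hpar x (by simpa using hx'.2) (hreach x hx'.1)).1
      refine Finset.mem_biUnion.2 ⟨H.connectedComponentMk x, (Finset.mem_filter.1 hx'.1).2, ?_⟩
      rw [Set.mem_toFinset]
      refine ⟨ha, ?_⟩
      intro v hv
      rw [ConnectedComponent.mem_supp_iff, ConnectedComponent.eq]
      rcases Sym2.mem_iff.1 hv with rfl | rfl
      · exact Reachable.refl _
      · exact ha.reachable.symm
  have hcard := Finset.card_le_card hsub
  rw [Finset.card_union_of_disjoint hdisj, hB] at hcard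
  have hA : A'.card = A.card := Finset.card_map _
  have := Finset.card_sdiff_add_card_eq_card hUV
  omega

/-- From a pseudoforest decomposition extract an ownership relation on the edges
outside of part `i`: each vertex owns at most `k` of them. -/
lemma decomp_orient {W : Type*} [Finite W] (G : SimpleGraph W) (k : ℕ)
    (P : Fin (k + 1) → Set (Sym2 W)) (hP : IsPseudoforestDecomp G (k + 1) P) (i : Fin (k + 1)) :
    ∃ own : W → W → Prop,
      (∀ x y, G.Adj x y → (fromEdgeSet (P i)).Adj x y ∨ own x y ∨ own y x) ∧
      (∀ x, {y | own x y}.ncard ≤ k) := by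
  classical
  obtain ⟨hsub, -, hun, hpf⟩ := hP
  choose f hinj hmem using fun j => pseudoforest_orient _ (hpf j)
  refine ⟨fun x y => ∃ j, j ≠ i ∧ ∃ h : (fromEdgeSet (P j)).Adj x y, f j ⟨s(x, y), h⟩ = x,
    ?_, ?_⟩
  · intro x y hxy
    have : s(x, y) ∈ ⋃ i, P i := by rw [hun]; exact hxy
    obtain ⟨j, hj⟩ := Set.mem_iUnion.1 this
    have hadj : (fromEdgeSet (P j)).Adj x y := (fromEdgeSet_adj _).2 ⟨hj, hxy.ne⟩
    by_cases hji : j = i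
    · subst hji; exact Or.inl hadj
    · right
      have := hmem j ⟨s(x, y), hadj⟩
      rcases Sym2.mem_iff.1 this with h | h
      · exact Or.inl ⟨j, hji, hadj, h⟩
      · refine Or.inr ⟨j, hji, hadj.symm, ?_⟩
        refine Eq.trans (congrArg (f j) ?_) h
        exact Subtype.ext Sym2.eq_swap
  · intro x
    choose! j hj using fun (y : W) (h : ∃ j, j ≠ i ∧
      ∃ h : (fromEdgeSet (P j)).Adj x y, f j ⟨s(x, y), h⟩ = x) => h
    have h1 : {y | ∃ j, j ≠ i ∧ ∃ h : (fromEdgeSet (P j)).Adj x y, f j ⟨s(x, y), h⟩ = x}.ncard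
        ≤ (↑(Finset.univ.erase i) : Set (Fin (k + 1))).ncard := by
      refine Set.ncard_le_ncard_of_injOn j ?_ ?_ (Set.toFinite _)
      · intro y hy
        simpa using (hj y hy).1
      · intro y hy y' hy' hyy
        obtain ⟨_, h, e⟩ := hj y hy
        obtain ⟨_, h', e'⟩ := hj y' hy'
        revert h' e'
        rw [← hyy]
        intro h' e'
        have := hinj _ (e.trans e'.symm)
        have := congrArg Subtype.val this
        exact Sym2.congr_right.1 this
    rw [Set.ncard_coe_finset] at h1
    simpa using h1

/-! ### The gadget tree -/

/-- Vertices of the gadget: `n + 1` spiders, each with a center, `k + 1` legs with `z + 1`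
vertices and `s` leaves. -/
inductive GX (k z s n : ℕ) : Type
  | ctr (i : Fin (n + 1)) : GX k z s n
  | leg (i : Fin (n + 1)) (a : Fin (k + 1)) (t : Fin (z + 1)) : GX k z s n
  | leaf (i : Fin (n + 1)) (j : Fin s) : GX k z s n
  deriving DecidableEq, Fintype

namespace GX

variable {k z s n : ℕ}

/-- `Par y x`: the vertex `x` is the parent of `y` in the gadget forest. -/
def Par : GX k z s n → GX k z s n → Prop
  | leg i a t, leg i' a' t' => i = i' ∧ a = a' ∧ t.val = t'.val + 1
  | leg i a t, ctr i' => i = i' ∧ t.val = 0 ∧ (a.val = k → i.val ≠ 0)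
  | leaf i _, ctr i' => i = i'
  | ctr i, leg i' a t => i.val = i'.val + 1 ∧ a.val = k ∧ t.val = 0
  | _, _ => False

/-- The capacity of a vertex. -/
def cap : GX k z s n → ℕ
  | ctr _ => k
  | leg i a t => if a.val = k ∧ t.val = 0 ∧ i.val ≠ 0 ∧ i.val ≠ n then 1 else 0
  | leaf _ _ => 0

/-- The index of the spider. -/
def unit : GX k z s n → ℕ
  | ctr i => i.val
  | leg i _ _ => i.val
  | leaf i _ => i.val

/-- The depth in the forest. -/
def rk : GX k z s n → ℕ
  | ctr i => 2 * i.val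
  | leg i _ t => 2 * i.val + 1 + t.val
  | leaf i _ => 2 * i.val + 1

/-- The distance to the center of spider `i`. -/
def dd (i : ℕ) : GX k z s n → ℕ
  | ctr j => 2 * ((j.val - i) + (i - j.val))
  | leg j a t => if a.val = k ∧ j.val < i then 2 * (i - j.val) + t.val - 1 else
      2 * ((j.val - i) + (i - j.val)) + t.val + 1
  | leaf j _ => 2 * ((j.val - i) + (i - j.val)) + 1

lemma par_rk {y x : GX k z s n} (h : Par y x) : rk x < rk y := by
  cases y <;> cases x <;> simp only [Par, rk] at h ⊢
  · omega
  · obtain ⟨rfl, h⟩ := h; omega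
  · obtain ⟨rfl, h⟩ := h; omega
  · subst h; omega

lemma par_unique {y x x' : GX k z s n} (h : Par y x) (h' : Par y x') : x = x' := by
  cases y <;> cases x <;> cases x' <;> simp only [Par] at h h'
  · congr 1 <;> apply Fin.ext <;> omega
  · obtain ⟨rfl, h⟩ := h; obtain ⟨rfl, h'⟩ := h'; rfl
  · omega
  · omega
  · obtain ⟨rfl, rfl, h⟩ := h; obtain ⟨rfl, rfl, h'⟩ := h'
    congr 1; apply Fin.ext; omega
  · rw [← h, ← h']

lemma cap_le (hk : 1 ≤ k) (x : GX k z s n) : cap x ≤ k := by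
  cases x <;> simp only [cap] <;> try split_ifs
  all_goals omega

lemma dd_leg (i : ℕ) (j : Fin (n + 1)) (a : Fin (k + 1)) (t : Fin (z + 1)) :
    ((a.val = k ∧ j.val < i) ∧
      dd i (leg j a t : GX k z s n) = 2 * (i - j.val) + t.val - 1) ∨
    (¬ (a.val = k ∧ j.val < i) ∧
      dd i (leg j a t : GX k z s n) = 2 * ((j.val - i) + (i - j.val)) + t.val + 1) := by
  by_cases h : a.val = k ∧ j.val < i
  · exact Or.inl ⟨h, by simp only [dd, if_pos h]⟩
  · exact Or.inr ⟨h, by simp only [dd, if_neg h]⟩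

lemma dd_ctr (i : ℕ) (j : Fin (n + 1)) :
    dd i (ctr j : GX k z s n) = 2 * ((j.val - i) + (i - j.val)) := rfl

lemma dd_leaf (i : ℕ) (j : Fin (n + 1)) (a : Fin s) :
    dd i (leaf j a : GX k z s n) = 2 * ((j.val - i) + (i - j.val)) + 1 := rfl

open Classical in
/-- Distance with negative sign on a set `B`. -/
noncomputable def sg (B : GX k z s n → Prop) (i : ℕ) (x : GX k z s n) : ℤ :=
  if B x then -(dd i x : ℤ) else dd i x

lemma sg_cases (B : GX k z s n → Prop) (i : ℕ) (x : GX k z s n) :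
    (B x ∧ sg B i x = -(dd i x : ℤ)) ∨ (¬ B x ∧ sg B i x = dd i x) := by
  by_cases h : B x
  · exact Or.inl ⟨h, by simp only [sg, if_pos h]⟩
  · exact Or.inr ⟨h, by simp only [sg, if_neg h]⟩

/-- Signed distance with respect to the part below spider `i`. -/
lemma lip_unit (i : ℕ) {y x : GX k z s n} (h : Par y x) :
    |sg (fun x => x.unit < i) i y - sg (fun x => x.unit < i) i x| ≤ 1 := by
  rw [abs_le]
  have hy := sg_cases (fun x => x.unit < i) i y
  have hx := sg_cases (fun x => x.unit < i) i x
  generalize sg (fun x => x.unit < i) i y = p at hy ⊢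
  generalize sg (fun x => x.unit < i) i x = q at hx ⊢
  cases y with
  | ctr j =>
    cases x with
    | ctr j' => exact h.elim
    | leg j' a t =>
      obtain ⟨h1, h2, h3⟩ := h
      have := dd_leg (s := s) i j' a t
      simp only [unit, dd_ctr] at hx hy
      omega
    | leaf j' a => exact h.elim
  | leg j a t =>
    have h1 := dd_leg (s := s) i j a t
    cases x with
    | ctr j' =>
      obtain ⟨rfl, h⟩ := h
      simp only [unit, dd_ctr] at hx hy
      omega
    | leg j' a' t' =>
      obtain ⟨rfl, rfl, h⟩ := h
      have h2 := dd_leg (s := s) i j a t'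
      simp only [unit] at hx hy
      omega
    | leaf j' a' => exact h.elim
  | leaf j a =>
    cases x with
    | ctr j' =>
      have h : j = j' := h
      subst h
      simp only [unit, dd_ctr, dd_leaf] at hx hy
      omega
    | leg j' a' t' => exact h.elim
    | leaf j' a' => exact h.elim

/-- The vertices of a leg. -/
def onLeg (i : Fin (n + 1)) (b : Fin (k + 1)) : GX k z s n → Prop
  | leg j a _ => j = i ∧ a = b
  | _ => False

lemma lip_leg (i : Fin (n + 1)) (b : Fin (k + 1)) (hb : b.val ≠ k) {y x : GX k z s n}
    (h : Par y x) : |sg (onLeg i b) i.val y - sg (onLeg i b) i.val x| ≤ 1 := by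
  rw [abs_le]
  have hy := sg_cases (onLeg i b) i.val y
  have hx := sg_cases (onLeg i b) i.val x
  generalize sg (onLeg i b) i.val y = p at hy ⊢
  generalize sg (onLeg i b) i.val x = q at hx ⊢
  cases y with
  | ctr j =>
    cases x with
    | ctr j' => exact h.elim
    | leg j' a t =>
      obtain ⟨h1, h2, h3⟩ := h
      have := dd_leg (s := s) i.val j' a t
      simp only [onLeg, dd_ctr, Fin.ext_iff, false_and, not_false_eq_true, true_and,
        false_or] at hx hy
      omega
    | leaf j' a => exact h.elim
  | leg j a t =>
    have h1 := dd_leg (s := s) i.val j a t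
    cases x with
    | ctr j' =>
      obtain ⟨rfl, h⟩ := h
      simp only [onLeg, dd_ctr, Fin.ext_iff, false_and, not_false_eq_true, true_and,
        false_or] at hx hy
      omega
    | leg j' a' t' =>
      obtain ⟨rfl, rfl, h⟩ := h
      have h2 := dd_leg (s := s) i.val j a t'
      simp only [onLeg, Fin.ext_iff] at hx hy
      omega
    | leaf j' a' => exact h.elim
  | leaf j a =>
    cases x with
    | ctr j' =>
      have h : j = j' := h
      subst h
      simp only [onLeg, dd_ctr, dd_leaf, false_and, not_false_eq_true, true_and,
        false_or] at hx hy
      omega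
    | leg j' a' t' => exact h.elim
    | leaf j' a' => exact h.elim

/-- The outcome we are after inside one gadget. -/
def Win (H : SimpleGraph (GX k z s n)) : Prop :=
  ∃ (w u v : GX k z s n) (A : Finset (GX k z s n)) (g : GX k z s n → ℤ),
    (∀ x ∈ A, H.Reachable w x) ∧ u ∈ A ∧ v ∈ A ∧ 2 * z + 3 + s ≤ A.card ∧
    (∀ y x, Par y x → |g y - g x| ≤ 1) ∧ 2 * (z : ℤ) + 2 ≤ g u - g v

/-- There is a long leg coming into the center of spider `i` which can only be cut at the center. -/
def Inc (H : SimpleGraph (GX k z s n)) (ow : GX k z s n → GX k z s n → Prop)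
    (i : Fin (n + 1)) : Prop :=
  ∃ (v u : GX k z s n) (A : Finset (GX k z s n)),
    Par (ctr i) v ∧ ¬ ow v (ctr i) ∧ u ∈ A ∧
    (∀ x ∈ A, H.Reachable v x ∧ x.unit < i.val) ∧ z + 1 ≤ A.card ∧ z + 1 ≤ dd i.val u

section core

variable {H : SimpleGraph (GX k z s n)} {ow : GX k z s n → GX k z s n → Prop}

lemma not_ow_of_cap (hc : ∀ x, {y | ow x y}.ncard ≤ cap x) {x y : GX k z s n}
    (h : cap x = 0) : ¬ ow x y := by
  intro hxy
  have h1 := hc x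
  rw [h, Nat.le_zero, Set.ncard_eq_zero (Set.toFinite _)] at h1
  have : y ∈ {y | ow x y} := hxy
  rw [h1] at this
  exact this

lemma ow_unique (hc : ∀ x, {y | ow x y}.ncard ≤ cap x) {x y y' : GX k z s n}
    (h : cap x ≤ 1) (h1 : ow x y) (h2 : ow x y') : y = y' :=
  (Set.ncard_le_one (Set.toFinite _)).1 ((hc x).trans h) _ h1 _ h2

/-- A leg whose first vertex does not own the second edge is intact. -/
lemma leg_reach (hpar : ∀ y x, Par y x → H.Adj y x ∨ ow y x ∨ ow x y)
    (hc : ∀ x, {y | ow x y}.ncard ≤ cap x) (i : Fin (n + 1)) (a : Fin (k + 1))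
    (h0 : ∀ t : Fin (z + 1), t.val = 1 → ¬ ow (leg i a 0) (leg i a t)) (t : Fin (z + 1)) :
    H.Reachable (leg i a 0) (leg i a t) := by
  obtain ⟨t, ht⟩ := t
  induction t with
  | zero => exact Reachable.refl _
  | succ t ih =>
    have ht' : t < z + 1 := by omega
    refine (ih ht').trans ?_
    have hp : Par (k := k) (z := z) (s := s) (leg i a ⟨t + 1, ht⟩) (leg i a ⟨t, ht'⟩) :=
      ⟨rfl, rfl, rfl⟩
    rcases hpar _ _ hp with h | h | h
    · exact h.symm.reachable
    · exact absurd h (not_ow_of_cap hc (by simp [cap]))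
    · exfalso
      by_cases h1 : t = 0
      · subst h1
        exact h0 ⟨1, ht⟩ rfl h
      · exact not_ow_of_cap hc (by simp [cap, h1]) h

/-- The first vertex of an item attached to the center of spider `i`: the incoming leg,
one of the `k + 1` legs, or a leaf. -/
def hd (v : GX k z s n) (i : Fin (n + 1)) : Option (Fin (k + 1) ⊕ Fin s) → GX k z s n
  | none => v
  | some (Sum.inl a) => leg i a 0
  | some (Sum.inr j) => leaf i j

lemma hd_inj {v : GX k z s n} {i : Fin (n + 1)} (hv : v.unit < i.val) :
    Function.Injective (hd v i) := by
  rintro (_ | a | a) (_ | b | b) h <;> simp only [hd] at h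
  · rfl
  · subst h; simp [unit] at hv
  · subst h; simp [unit] at hv
  · subst h; simp [unit] at hv
  · cases h; rfl
  · cases h
  · subst h; simp [unit] at hv
  · cases h
  · cases h; rfl

lemma unit_lt_of_par {v : GX k z s n} {i : Fin (n + 1)} (h : Par (ctr i) v) :
    v.unit < i.val := by
  cases v with
  | ctr j => exact h.elim
  | leg j a t => have := h.1; simp only [unit]; omega
  | leaf j a => exact h.elim

open Classical in
lemma cut_card (hc : ∀ x, {y | ow x y}.ncard ≤ cap x) {v : GX k z s n} {i : Fin (n + 1)}
    (hv : v.unit < i.val) :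
    (Finset.univ.filter (fun r => ow (ctr i) (hd v i r))).card ≤ k := by
  have h1 : (↑(Finset.univ.filter (fun r => ow (ctr i) (hd v i r))) :
      Set (Option (Fin (k + 1) ⊕ Fin s))).ncard ≤ {y | ow (ctr i) y}.ncard := by
    refine Set.ncard_le_ncard_of_injOn (hd v i) ?_ ((hd_inj hv).injOn) (Set.toFinite _)
    intro r hr
    simpa using hr
  rw [Set.ncard_coe_finset] at h1
  exact h1.trans (hc _)

/-- Uncut items are attached to the center. -/
lemma adj_hd (hpar : ∀ y x, Par y x → H.Adj y x ∨ ow y x ∨ ow x y)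
    (hc : ∀ x, {y | ow x y}.ncard ≤ cap x) {v : GX k z s n} {i : Fin (n + 1)}
    (hv : Par (ctr i) v) (hv' : ¬ ow v (ctr i))
    (hmain : ¬ ow (leg i (Fin.last k) 0) (ctr i)) (r : Option (Fin (k + 1) ⊕ Fin s))
    (hr : ¬ ow (ctr i) (hd v i r)) : H.Adj (ctr i) (hd v i r) := by
  have hi : i.val ≠ 0 := by have := unit_lt_of_par hv; omega
  rcases r with _ | a | j
  · rcases hpar _ _ hv with h | h | h
    · exact h
    · exact absurd h hr
    · exact absurd h hv'
  · have hp : Par (leg i a 0 : GX k z s n) (ctr i) := ⟨rfl, rfl, fun _ => hi⟩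
    rcases hpar _ _ hp with h | h | h
    · exact h.symm
    · by_cases ha : a = Fin.last k
      · subst ha; exact absurd h hmain
      · refine absurd h (not_ow_of_cap hc ?_)
        have : a.val ≠ k := fun h => ha (Fin.ext h)
        simp [cap, this]
    · exact absurd h hr
  · have hp : Par (leaf i j : GX k z s n) (ctr i) := rfl
    rcases hpar _ _ hp with h | h | h
    · exact h.symm
    · exact absurd h (not_ow_of_cap hc rfl)
    · exact absurd h hr

open Classical in
/-- The set of vertices contributed by an item. -/
noncomputable def itemSet (H : SimpleGraph (GX k z s n)) (i : Fin (n + 1))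
    (A : Finset (GX k z s n)) : Option (Fin (k + 1) ⊕ Fin s) → Finset (GX k z s n)
  | none => A
  | some (Sum.inl a) => (Finset.univ.filter
      (fun t => H.Reachable (leg i a 0) (leg i a t))).image (leg i a)
  | some (Sum.inr j) => {leaf i j}

/-- Long items. -/
def Long (H : SimpleGraph (GX k z s n)) (i : Fin (n + 1)) :
    Option (Fin (k + 1) ⊕ Fin s) → Prop
  | none => True
  | some (Sum.inl a) => ∀ t, H.Reachable (leg i a 0) (leg i a t)
  | some (Sum.inr _) => False

/-- The far end of an item. -/
def tip (i : Fin (n + 1)) (u : GX k z s n) : Option (Fin (k + 1) ⊕ Fin s) → GX k z s n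
  | none => u
  | some (Sum.inl a) => leg i a (Fin.last z)
  | some (Sum.inr j) => leaf i j

lemma itemSet_reach {v u : GX k z s n} {A : Finset (GX k z s n)} {i : Fin (n + 1)}
    (hA : ∀ x ∈ A, H.Reachable v x ∧ x.unit < i.val) (r : Option (Fin (k + 1) ⊕ Fin s)) :
    ∀ x ∈ itemSet H i A r, H.Reachable (hd v i r) x := by
  intro x hx
  rcases r with _ | a | j
  · exact (hA x hx).1
  · simp only [itemSet, Finset.mem_image, Finset.mem_filter, Finset.mem_univ, true_and] at hx
    obtain ⟨t, ht, rfl⟩ := hx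
    exact ht
  · simp only [itemSet, Finset.mem_singleton] at hx
    subst hx
    exact Reachable.refl _

lemma tip_mem {u : GX k z s n} {A : Finset (GX k z s n)} {i : Fin (n + 1)} (hu : u ∈ A)
    {r : Option (Fin (k + 1) ⊕ Fin s)} (hr : Long H i r) : tip i u r ∈ itemSet H i A r := by
  rcases r with _ | a | j
  · exact hu
  · simp only [itemSet, tip, Finset.mem_image, Finset.mem_filter, Finset.mem_univ, true_and]
    exact ⟨_, hr _, rfl⟩
  · exact hr.elim

lemma long_card {A : Finset (GX k z s n)} {i : Fin (n + 1)} (hA : z + 1 ≤ A.card)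
    {r : Option (Fin (k + 1) ⊕ Fin s)} (hr : Long H i r) : z + 1 ≤ (itemSet H i A r).card := by
  classical
  rcases r with _ | a | j
  · exact hA
  · simp only [itemSet]
    rw [Finset.card_image_of_injective _ (fun t t' h => by simpa using h),
      Finset.filter_true_of_mem (fun t _ => hr t)]
    simp
  · exact hr.elim

lemma item_card {A : Finset (GX k z s n)} {i : Fin (n + 1)} (hA : z + 1 ≤ A.card)
    (r : Option (Fin (k + 1) ⊕ Fin s)) : 1 ≤ (itemSet H i A r).card := by
  rcases r with _ | a | j
  · simp only [itemSet]; omega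
  · rw [Nat.succ_le_iff, Finset.card_pos]
    refine ⟨leg i a 0, ?_⟩
    simp only [itemSet, Finset.mem_image, Finset.mem_filter, Finset.mem_univ, true_and]
    exact ⟨0, Reachable.refl _, rfl⟩
  · simp [itemSet]

lemma item_unit {A : Finset (GX k z s n)} {i : Fin (n + 1)} {r : Fin (k + 1) ⊕ Fin s} {x}
    (hx : x ∈ itemSet H i A (some r)) : x.unit = i.val := by
  rcases r with a | j
  · simp only [itemSet, Finset.mem_image, Finset.mem_filter, Finset.mem_univ, true_and] at hx
    obtain ⟨t, ht, rfl⟩ := hx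
    rfl
  · simp only [itemSet, Finset.mem_singleton] at hx
    subst hx; rfl

lemma item_disj {v : GX k z s n} {A : Finset (GX k z s n)} {i : Fin (n + 1)}
    (hA : ∀ x ∈ A, H.Reachable v x ∧ x.unit < i.val) {r r' : Option (Fin (k + 1) ⊕ Fin s)}
    (h : r ≠ r') : Disjoint (itemSet H i A r) (itemSet H i A r') := by
  rw [Finset.disjoint_left]
  intro x hx hx'
  rcases r with _ | r
  · rcases r' with _ | r'
    · exact h rfl
    · have h1 := (hA x hx).2
      have h2 := item_unit hx'
      omega
  · rcases r' with _ | r'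
    · have h1 := (hA x hx').2
      have h2 := item_unit hx
      omega
    · rcases r with a | a <;> rcases r' with b | b <;>
        simp only [itemSet, Finset.mem_image, Finset.mem_filter, Finset.mem_univ, true_and,
          Finset.mem_singleton] at hx hx'
      · obtain ⟨t, -, rfl⟩ := hx
        obtain ⟨t', -, h'⟩ := hx'
        simp only [leg.injEq] at h'
        exact h (by rw [h'.2.1])
      · obtain ⟨t, -, rfl⟩ := hx
        cases hx'
      · obtain ⟨t, -, rfl⟩ := hx'
        cases hx
      · subst hx
        simp only [leaf.injEq] at hx'
        exact h (by rw [hx'.2])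

lemma win_of (hpar : ∀ y x, Par y x → H.Adj y x ∨ ow y x ∨ ow x y)
    (hc : ∀ x, {y | ow x y}.ncard ≤ cap x) {v u : GX k z s n} {A : Finset (GX k z s n)}
    {i : Fin (n + 1)}
    (hv : Par (ctr i) v) (hv' : ¬ ow v (ctr i)) (hu : u ∈ A)
    (hA : ∀ x ∈ A, H.Reachable v x ∧ x.unit < i.val) (hAc : z + 1 ≤ A.card)
    (hdu : z + 1 ≤ dd i.val u)
    (hmain : ¬ ow (leg i (Fin.last k) 0) (ctr i)) {p q : Option (Fin (k + 1) ⊕ Fin s)}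
    (hpq : p ≠ q) (hp : Long H i p) (hq : Long H i q)
    (hp' : ¬ ow (ctr i) (hd v i p)) (hq' : ¬ ow (ctr i) (hd v i q))
    (hqm : q ≠ some (Sum.inl (Fin.last k))) : Win H := by
  classical
  have hvi := unit_lt_of_par hv
  set C := Finset.univ.filter (fun r => ow (ctr i) (hd v i r)) with hC
  have hCc : C.card ≤ k := cut_card hc hvi
  let U := Cᶜ.biUnion (itemSet H i A)
  have hmemC : ∀ r, r ∈ Cᶜ ↔ ¬ ow (ctr i) (hd v i r) := by intro r; simp [hC]
  have hUr : ∀ x ∈ insert (ctr i) U, H.Reachable (ctr i) x := by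
    intro x hx
    rcases Finset.mem_insert.1 hx with rfl | hx
    · exact Reachable.refl _
    · obtain ⟨r, hr, hx⟩ := Finset.mem_biUnion.1 hx
      exact (adj_hd hpar hc hv hv' hmain r ((hmemC r).1 hr)).reachable.trans
        (itemSet_reach (u := u) hA r x hx)
  have hctr : ctr i ∉ U := by
    intro h
    obtain ⟨r, hr, hx⟩ := Finset.mem_biUnion.1 h
    rcases r with _ | a | j
    · have := (hA _ hx).2
      simp [unit] at this
    · simp [itemSet] at hx
    · simp [itemSet] at hx
  have hUcard : U.card = ∑ r ∈ Cᶜ, (itemSet H i A r).card :=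
    Finset.card_biUnion (fun r _ r' _ h => item_disj hA h)
  have hsum : ∑ r ∈ Cᶜ, (1 + ((if r = p then z else 0) + (if r = q then z else 0))) ≤
      ∑ r ∈ Cᶜ, (itemSet H i A r).card := by
    refine Finset.sum_le_sum fun r _ => ?_
    by_cases h1 : r = p
    · subst h1
      have := long_card (H := H) hAc hp
      simp [hpq]; omega
    · by_cases h2 : r = q
      · subst h2
        have := long_card (H := H) hAc hq
        simp [h1]; omega
      · have := item_card (H := H) (i := i) hAc r
        simp only [h1, h2, if_false]; omega
  rw [Finset.sum_add_distrib, Finset.sum_add_distrib, Finset.sum_ite_eq', Finset.sum_ite_eq',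
    if_pos ((hmemC p).2 hp'), if_pos ((hmemC q).2 hq'), Finset.sum_const, smul_eq_mul,
    Finset.card_compl] at hsum
  simp only [Fintype.card_option, Fintype.card_sum, Fintype.card_fin] at hsum
  have htp : tip i u p ∈ insert (ctr i) U := Finset.mem_insert_of_mem
    (Finset.mem_biUnion.2 ⟨p, (hmemC p).2 hp', tip_mem hu hp⟩)
  have htq : tip i u q ∈ insert (ctr i) U := Finset.mem_insert_of_mem
    (Finset.mem_biUnion.2 ⟨q, (hmemC q).2 hq', tip_mem hu hq⟩)
  have hddt : ∀ r, Long H i r → z + 1 ≤ dd i.val (tip i u r) := by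
    intro r hr
    rcases r with _ | a | j
    · exact hdu
    · have := dd_leg (s := s) i.val i a (Fin.last z)
      simp only [tip]
      simp only [Fin.val_last] at this
      omega
    · exact hr.elim
  have hfin : ∀ B : GX k z s n → Prop, ¬ B (tip i u p) → B (tip i u q) →
      (∀ y x, Par y x → |sg B i.val y - sg B i.val x| ≤ 1) → Win H := by
    intro B hBp hBq hB
    refine ⟨ctr i, _, _, insert (ctr i) U, sg B i.val, hUr, htp, htq, ?_, hB, ?_⟩
    · rw [Finset.card_insert_of_notMem hctr]
      omega
    · have h1 := hddt p hp
      have h2 := hddt q hq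
      simp only [sg, if_neg hBp, if_pos hBq]
      omega
  rcases q with _ | b | j
  · refine hfin (fun x => x.unit < i.val) ?_ ((hA u hu).2) (fun y x h => lip_unit _ h)
    rcases p with _ | p
    · exact absurd rfl hpq
    · have := item_unit (tip_mem hu hp)
      omega
  · refine hfin (onLeg i b) ?_ ⟨rfl, rfl⟩ (fun y x h => lip_leg i b ?_ h)
    · rcases p with _ | a | j
      · have h1 := (hA u hu).2
        simp only [tip]
        intro h
        cases u with
        | ctr j => exact h
        | leg j a t => have := h.1; subst this; simp [unit] at h1
        | leaf j a => exact h
      · intro h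
        exact hpq (by rw [h.2])
      · exact hp.elim
    · intro h
      exact hqm (by rw [show b = Fin.last k from Fin.ext h])
  · exact hq.elim

lemma win_of' (hpar : ∀ y x, Par y x → H.Adj y x ∨ ow y x ∨ ow x y)
    (hc : ∀ x, {y | ow x y}.ncard ≤ cap x) {v u : GX k z s n} {A : Finset (GX k z s n)}
    {i : Fin (n + 1)}
    (hv : Par (ctr i) v) (hv' : ¬ ow v (ctr i)) (hu : u ∈ A)
    (hA : ∀ x ∈ A, H.Reachable v x ∧ x.unit < i.val) (hAc : z + 1 ≤ A.card)
    (hdu : z + 1 ≤ dd i.val u)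
    (hmain : ¬ ow (leg i (Fin.last k) 0) (ctr i)) {p q : Option (Fin (k + 1) ⊕ Fin s)}
    (hpq : p ≠ q) (hp : Long H i p) (hq : Long H i q)
    (hp' : ¬ ow (ctr i) (hd v i p)) (hq' : ¬ ow (ctr i) (hd v i q)) : Win H := by
  by_cases h : q = some (Sum.inl (Fin.last k))
  · exact win_of hpar hc hv hv' hu hA hAc hdu hmain hpq.symm hq hp hq' hp' (by rw [← h]; exact hpq)
  · exact win_of hpar hc hv hv' hu hA hAc hdu hmain hpq hp hq hp' hq' (h)

/-- The induction step along the chain of spiders. -/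
lemma step (hpar : ∀ y x, Par y x → H.Adj y x ∨ ow y x ∨ ow x y)
    (hc : ∀ x, {y | ow x y}.ncard ≤ cap x) (i : Fin (n + 1)) (hinc : Inc H ow i) :
    Win H ∨ ∃ i' : Fin (n + 1), i'.val = i.val + 1 ∧ Inc H ow i' := by
  classical
  obtain ⟨v, u, A, hv, hv', hu, hA, hAc, hdu⟩ := hinc
  have hvi := unit_lt_of_par hv
  have hi0 : i.val ≠ 0 := by omega
  have hcap1 : cap (leg i (Fin.last k) 0 : GX k z s n) ≤ 1 := by
    simp only [cap]; split_ifs <;> omega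
  have hin : ∀ y, ow (leg i (Fin.last k) 0) y → i.val < n := by
    intro y hy
    by_contra hlt
    have : i.val = n := by omega
    exact not_ow_of_cap hc (by simp [cap, this]) hy
  have hpend : ∀ a : Fin (k + 1), a ≠ Fin.last k → Long H i (some (Sum.inl a)) := by
    intro a ha
    have ha' : a.val ≠ k := fun h => ha (Fin.ext h)
    exact leg_reach hpar hc i a (fun t _ => not_ow_of_cap hc (by simp [cap, ha']))
  by_cases hmain : ow (leg i (Fin.last k) 0) (ctr i)
  · right
    have hlt := hin _ hmain
    refine ⟨⟨i.val + 1, by omega⟩, rfl, leg i (Fin.last k) 0, leg i (Fin.last k) (Fin.last z),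
      Finset.univ.image (leg i (Fin.last k)), ⟨rfl, rfl, rfl⟩, ?_, ?_, ?_, ?_, ?_⟩
    · intro h
      have := ow_unique hc hcap1 hmain h
      simp only [ctr.injEq, Fin.ext_iff] at this
      omega
    · exact Finset.mem_image_of_mem _ (Finset.mem_univ _)
    · intro x hx
      obtain ⟨t, -, rfl⟩ := Finset.mem_image.1 hx
      refine ⟨leg_reach hpar hc i _ (fun t' _ h => ?_) t, by simp [unit]⟩
      have := ow_unique hc hcap1 hmain h
      cases this
    · rw [Finset.card_image_of_injective _ (fun t t' h => by simpa using h)]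
      simp
    · have := dd_leg (s := s) (i.val + 1) i (Fin.last k) (Fin.last z)
      simp only [Fin.val_last] at this
      change z + 1 ≤ dd (i.val + 1) _
      omega
  set C := Finset.univ.filter (fun r => ow (ctr i) (hd v i r)) with hC
  have hCc : C.card ≤ k := cut_card hc hvi
  have hmemC : ∀ r, r ∈ C ↔ ow (ctr i) (hd v i r) := by intro r; simp [hC]
  let Ls : Finset (Option (Fin (k + 1) ⊕ Fin s)) :=
    insert none (Finset.univ.image (fun a => some (Sum.inl a)))
  have hLs : Ls.card = k + 2 := by
    rw [Finset.card_insert_of_notMem (by simp),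
      Finset.card_image_of_injective _ (fun a b h => by simpa using h)]
    simp
  have hLs' : (Ls.erase (some (Sum.inl (Fin.last k)))).card = k + 1 := by
    rw [Finset.card_erase_of_mem (by simp [Ls]), hLs]; rfl
  by_cases hdown : ∀ t : Fin (z + 1), t.val = 1 →
      ¬ ow (leg i (Fin.last k) 0) (leg i (Fin.last k) t)
  · left
    have hlong : ∀ r ∈ Ls, Long H i r := by
      intro r hr
      rcases Finset.mem_insert.1 hr with rfl | hr
      · trivial
      · obtain ⟨a, -, rfl⟩ := Finset.mem_image.1 hr
        by_cases ha : a = Fin.last k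
        · subst ha; exact leg_reach hpar hc i _ hdown
        · exact hpend a ha
    have : 1 < (Ls \ C).card := by
      have := Finset.le_card_sdiff C Ls
      omega
    obtain ⟨p, hp, q, hq, hpq⟩ := Finset.one_lt_card.1 this
    rw [Finset.mem_sdiff, hmemC] at hp hq
    exact win_of' hpar hc hv hv' hu hA hAc hdu hmain hpq (hlong p hp.1) (hlong q hq.1) hp.2 hq.2
  · push Not at hdown
    obtain ⟨t1, ht1, how⟩ := hdown
    have hlt := hin _ how
    have hlong : ∀ r ∈ Ls.erase (some (Sum.inl (Fin.last k))), Long H i r := by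
      intro r hr
      obtain ⟨hne, hr⟩ := Finset.mem_erase.1 hr
      rcases Finset.mem_insert.1 hr with rfl | hr
      · trivial
      · obtain ⟨a, -, rfl⟩ := Finset.mem_image.1 hr
        exact hpend a (fun h => hne (by rw [h]))
    set Lp := Ls.erase (some (Sum.inl (Fin.last k))) with hLp
    by_cases htwo : 1 < (Lp \ C).card
    · left
      obtain ⟨p, hp, q, hq, hpq⟩ := Finset.one_lt_card.1 htwo
      rw [Finset.mem_sdiff, hmemC] at hp hq
      exact win_of' hpar hc hv hv' hu hA hAc hdu hmain hpq (hlong p hp.1) (hlong q hq.1) hp.2 hq.2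
    · right
      have hone : 0 < (Lp \ C).card := by
        have := Finset.le_card_sdiff C Lp
        omega
      obtain ⟨p, hp⟩ := Finset.card_pos.1 hone
      rw [Finset.mem_sdiff, hmemC] at hp
      have hmc : some (Sum.inl (Fin.last k)) ∉ C := by
        intro hm
        have h1 : insert (some (Sum.inl (Fin.last k))) (Lp ∩ C) ⊆ C := by
          intro x hx
          rcases Finset.mem_insert.1 hx with rfl | hx
          · exact hm
          · exact (Finset.mem_inter.1 hx).2
        have h2 := Finset.card_le_card h1
        rw [Finset.card_insert_of_notMem (by simp [hLp])] at h2
        have h3 := Finset.card_sdiff_add_card_inter Lp C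
        omega
      have hadjm := adj_hd hpar hc hv hv' hmain _ (fun h => hmc ((hmemC _).2 h))
      have hadjp := adj_hd hpar hc hv hv' hmain p hp.2
      have hreach : H.Reachable (leg i (Fin.last k) 0) (hd v i p) :=
        hadjm.symm.reachable.trans hadjp.reachable
      refine ⟨⟨i.val + 1, by omega⟩, rfl, leg i (Fin.last k) 0, tip i u p,
        itemSet H i A p, ⟨rfl, rfl, rfl⟩, ?_, tip_mem hu (hlong p hp.1), ?_,
        long_card hAc (hlong p hp.1), ?_⟩
      · intro h
        have := ow_unique hc hcap1 how h
        cases this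
      · intro x hx
        refine ⟨hreach.trans (itemSet_reach (u := u) hA p x hx), ?_⟩
        rcases p with _ | r
        · have := (hA x hx).2
          simp only; omega
        · have := item_unit hx
          simp only; omega
      · rcases p with _ | a | j
        · have h1 := (hA u hu).2
          simp only [tip]
          cases u with
          | ctr j => simp only [unit, dd_ctr] at h1 hdu ⊢; omega
          | leg j a t =>
            have h2 := dd_leg (s := s) i.val j a t
            have h3 := dd_leg (s := s) (i.val + 1) j a t
            simp only [unit] at h1
            omega
          | leaf j a => simp only [unit, dd_leaf] at h1 hdu ⊢; omega
        · have ha : a ≠ Fin.last k := by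
            rintro rfl
            simp [hLp] at hp
          have ha' : a.val ≠ k := fun h => ha (Fin.ext h)
          have h3 := dd_leg (s := s) (i.val + 1) i a (Fin.last z)
          simp only [tip]
          simp only [Fin.val_last] at h3
          omega
        · exact (hlong _ hp.1).elim

/-- Every admissible cutting of the gadget leaves a large component of large diameter. -/
lemma core_win (hn : 1 ≤ n) (hpar : ∀ y x, Par y x → H.Adj y x ∨ ow y x ∨ ow x y)
    (hc : ∀ x, {y | ow x y}.ncard ≤ cap x) : Win H := by
  classical
  by_contra hw
  have key : ∀ j : ℕ, ∃ i : Fin (n + 1), i.val = j + 1 ∧ Inc H ow i := by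
    intro j
    induction j with
    | zero =>
      have hcap0 : cap (leg 0 (Fin.last k) 0 : GX k z s n) = 0 := by simp [cap]
      refine ⟨⟨1, by omega⟩, rfl, leg 0 (Fin.last k) 0, leg 0 (Fin.last k) (Fin.last z),
        Finset.univ.image (leg 0 (Fin.last k)), ⟨rfl, rfl, rfl⟩, not_ow_of_cap hc hcap0,
        ?_, ?_, ?_, ?_⟩
      · exact Finset.mem_image_of_mem _ (Finset.mem_univ _)
      · intro x hx
        obtain ⟨t, -, rfl⟩ := Finset.mem_image.1 hx
        exact ⟨leg_reach hpar hc 0 _ (fun t' _ => not_ow_of_cap hc hcap0) t, by simp [unit]⟩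
      · rw [Finset.card_image_of_injective _ (fun t t' h => by simpa using h)]
        simp
      · have := dd_leg (s := s) 1 (0 : Fin (n + 1)) (Fin.last k) (Fin.last z)
        simp only [Fin.val_last, Fin.val_zero] at this
        simp only
        omega
    | succ j ih =>
      obtain ⟨i, hi, hI⟩ := ih
      rcases step hpar hc i hI with h | ⟨i', h1, h2⟩
      · exact absurd h hw
      · exact ⟨i', by omega, h2⟩
  obtain ⟨i, hi, -⟩ := key n
  omega

end core

end GX

/-! ### The weights -/

namespace GX

variable {k z s n : ℕ}

/-- The share of the edge to its parent which is paid by a vertex. -/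
noncomputable def wt (τ θ e : ℝ) : GX k z s n → ℝ
  | ctr i => if i.val = 0 then 0 else θ - (2 * (i.val : ℝ) - 2) * e
  | leg i a t => if a.val = k ∧ t.val = 0 then
      (if i.val = 0 then 0 else 1 - (2 * (i.val : ℝ) - 1) * e)
      else 1 - ((z : ℝ) + 1 - t.val) * τ
  | leaf _ _ => 1 - τ

lemma wt_bounds {τ θ e : ℝ} (hτ : 0 ≤ τ) (hθ : θ = (z + 1) * τ) (hθ1 : θ ≤ 1) (he : 0 ≤ e)
    (hne : 2 * (n : ℝ) * e = θ) (x : GX k z s n) :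
    0 ≤ wt τ θ e x ∧ wt τ θ e x ≤ 1 := by
  have hz0 : (0 : ℝ) ≤ z := Nat.cast_nonneg z
  have hθ0 : 0 ≤ θ := by rw [hθ]; positivity
  cases x with
  | ctr i =>
    have hi : (i.val : ℝ) ≤ n := by exact_mod_cast Nat.lt_succ_iff.1 i.2
    simp only [wt]
    split_ifs with h
    · simp
    · have h1 : (1 : ℝ) ≤ i.val := by exact_mod_cast Nat.one_le_iff_ne_zero.2 h
      constructor <;> nlinarith
  | leg i a t =>
    have hi : (i.val : ℝ) ≤ n := by exact_mod_cast Nat.lt_succ_iff.1 i.2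
    have ht : (t.val : ℝ) ≤ z := by exact_mod_cast Nat.lt_succ_iff.1 t.2
    have ht0 : (0 : ℝ) ≤ t.val := Nat.cast_nonneg _
    simp only [wt]
    split_ifs with h h
    · simp
    · have h1 : (1 : ℝ) ≤ i.val := by exact_mod_cast Nat.one_le_iff_ne_zero.2 h
      constructor <;> nlinarith
    · constructor <;> nlinarith
  | leaf i j =>
    simp only [wt]
    constructor <;> nlinarith

lemma sum_cover {α : Type*} [DecidableEq α] (w : α → ℝ) (hw : ∀ x, 0 ≤ w x) (F A B : Finset α)
    (h : F ⊆ A ∪ B) : ∑ x ∈ F, w x ≤ ∑ x ∈ A, w x + ∑ x ∈ B, w x := by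
  refine (Finset.sum_le_sum_of_subset_of_nonneg h (fun x _ _ => hw x)).trans ?_
  rw [← Finset.sum_union_inter]
  have : 0 ≤ ∑ x ∈ A ∩ B, w x := Finset.sum_nonneg fun x _ => hw x
  linarith

open Classical in
lemma load_le (hn : 1 ≤ n) {τ θ e : ℝ} (hτ : 0 ≤ τ) (hθ : θ = (z + 1) * τ) (hθ1 : θ ≤ 1)
    (he : 0 ≤ e) (hne : 2 * (n : ℝ) * e = θ) (hs : k * θ + s * τ + τ = k + 1 - θ)
    (x : GX k z s n) :
    (k : ℝ) - cap x + wt τ θ e x + ∑ y ∈ Finset.univ.filter (fun y => Par y x), (1 - wt τ θ e y)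
      ≤ k + (1 - τ) + e := by
  have hz0 : (0 : ℝ) ≤ z := Nat.cast_nonneg z
  have hθ0 : 0 ≤ θ := by rw [hθ]; positivity
  have hw : ∀ y : GX k z s n, 0 ≤ 1 - wt τ θ e y := fun y => by
    have := (wt_bounds hτ hθ hθ1 he hne y).2; linarith
  cases x with
  | ctr i =>
    have h1 := sum_cover (fun y : GX k z s n => 1 - wt τ θ e y) hw
      (Finset.univ.filter (fun y => Par y (ctr i)))
      (Finset.univ.image (fun a : Fin k => leg i a.castSucc 0))
      (Finset.univ.image (leaf i) ∪ (if i.val = 0 then ∅ else {leg i (Fin.last k) 0})) (by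
        intro y hy
        have hy : Par y (ctr i) := by simpa using hy
        cases y with
        | ctr j => exact hy.elim
        | leg j a t =>
          obtain ⟨rfl, h2, h3⟩ := hy
          have ht : t = 0 := Fin.ext h2
          subst ht
          induction a using Fin.lastCases with
          | last =>
            have := h3 (by simp)
            simp [this]
          | cast a => simp
        | leaf j a =>
          have hy : j = i := hy
          subst hy
          simp)
    have h2 := sum_cover (fun y : GX k z s n => 1 - wt τ θ e y) hw _ _ _
      (Finset.Subset.refl
        (Finset.univ.image (leaf i) ∪ (if i.val = 0 then ∅ else {leg i (Fin.last k) 0})))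
    rw [Finset.sum_image (fun a _ b _ h => by simpa using h)] at h1 h2
    have h3 : ∀ a : Fin k, 1 - wt τ θ e (leg i a.castSucc 0 : GX k z s n) = θ := by
      intro a
      have : a.val ≠ k := a.2.ne
      simp [wt, this, hθ]
    simp only [h3, Finset.sum_const, Finset.card_univ, Fintype.card_fin, nsmul_eq_mul] at h1
    simp only [wt, sub_sub_cancel, Finset.sum_const, Finset.card_univ, Fintype.card_fin,
      nsmul_eq_mul] at h2
    by_cases hi : i.val = 0
    · simp only [hi, if_true, Finset.sum_empty, wt, cap] at h1 h2 ⊢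
      linarith
    · simp only [hi, if_false, Finset.sum_singleton, wt, cap, Fin.val_last, Fin.val_zero,
        and_self, if_true] at h1 h2 ⊢
      linarith
  | leg i a t =>
    have h1 := sum_cover (fun y : GX k z s n => 1 - wt τ θ e y) hw
      (Finset.univ.filter (fun y => Par y (leg i a t)))
      (if h : t.val + 1 < z + 1 then {leg i a ⟨t.val + 1, h⟩} else ∅)
      (if h : (a.val = k ∧ t.val = 0) ∧ i.val + 1 < n + 1 then {ctr ⟨i.val + 1, h.2⟩} else ∅) (by
        intro y hy
        have hy : Par y (leg i a t) := by simpa using hy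
        cases y with
        | ctr j =>
          obtain ⟨h1, h2⟩ := hy
          have hj : i.val + 1 < n + 1 := h1 ▸ j.2
          rw [Finset.mem_union]
          right
          rw [dif_pos ⟨h2, hj⟩]
          rw [Finset.mem_singleton]
          congr 1
          exact Fin.ext h1
        | leg j b t' =>
          obtain ⟨rfl, rfl, h2⟩ := hy
          have ht : t.val + 1 < z + 1 := h2 ▸ t'.2
          rw [Finset.mem_union, dif_pos ht]
          left
          rw [Finset.mem_singleton]
          congr 1
          exact Fin.ext h2
        | leaf j a => exact hy.elim)
    have h2 : ∑ y ∈ (if h : t.val + 1 < z + 1 then {leg i a ⟨t.val + 1, h⟩} else ∅ :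
        Finset (GX k z s n)), (1 - wt τ θ e y) ≤ ((z : ℝ) - t.val) * τ := by
      have ht : (t.val : ℝ) ≤ z := by exact_mod_cast Nat.lt_succ_iff.1 t.2
      split_ifs with h
      · simp [wt]
      · rw [Finset.sum_empty]; exact mul_nonneg (by linarith) hτ
    replace h1 := h1.trans (add_le_add_left h2 _)
    clear h2
    by_cases hm : a.val = k ∧ t.val = 0
    · have ht0 : (t.val : ℝ) = 0 := by rw [hm.2]; simp
      rw [ht0] at h1
      by_cases hin : i.val + 1 < n + 1
      · rw [dif_pos (⟨hm, hin⟩ : (a.val = k ∧ t.val = 0) ∧ i.val + 1 < n + 1)] at h1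
        have hn' : i.val ≠ n := by omega
        by_cases hi : i.val = 0
        · simp [wt, cap, hm, hi] at h1 ⊢
          nlinarith
        · simp [wt, cap, hm, hi, hn'] at h1 ⊢
          nlinarith
      · rw [dif_neg (c := (a.val = k ∧ t.val = 0) ∧ i.val + 1 < n + 1)
          (fun h => hin h.2)] at h1
        have hi : i.val = n := by have := i.2; omega
        have hi' : ¬ n = 0 := by omega
        simp [wt, cap, hm, hi, hi'] at h1 ⊢
        nlinarith
    · rw [dif_neg (c := (a.val = k ∧ t.val = 0) ∧ i.val + 1 < n + 1)
        (fun h => hm h.1)] at h1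
      have hc : cap (leg i a t : GX k z s n) = 0 := by
        simp only [cap]; rw [if_neg]; exact fun h => hm ⟨h.1, h.2.1⟩
      have hwt : wt τ θ e (leg i a t : GX k z s n) = 1 - ((z : ℝ) + 1 - t.val) * τ := by
        simp only [wt]; rw [if_neg hm]
      rw [hc, hwt]
      simp only [Finset.sum_empty, Nat.cast_zero] at h1 ⊢
      nlinarith
  | leaf i j =>
    have h1 : Finset.univ.filter (fun y : GX k z s n => Par y (leaf i j)) = ∅ := by
      rw [Finset.filter_eq_empty_iff]
      intro y _ hy
      cases y <;> exact hy.elim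
    rw [h1]
    simp only [wt, cap, Finset.sum_empty, Nat.cast_zero]
    linarith

end GX

/-! ### The graph -/

namespace GX

variable {k z s n m : ℕ}

/-- Oriented edges of the graph: forest edges point to the parent, the other edges to hubs. -/
def RR : (Fin k ⊕ (Fin m × GX k z s n)) → (Fin k ⊕ (Fin m × GX k z s n)) → Prop
  | Sum.inr (c, y), Sum.inr (c', x) => c = c' ∧ Par y x
  | Sum.inr (_, y), Sum.inl j => cap y ≤ j.val
  | Sum.inl _, _ => False

/-- Many copies of the gadget, attached to `k` hubs. -/
def GV (k z s n m : ℕ) : SimpleGraph (Fin k ⊕ (Fin m × GX k z s n)) where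
  Adj p q := RR p q ∨ RR q p
  symm := ⟨fun _ _ h => h.symm⟩
  loopless := ⟨by
    rintro (j | ⟨c, x⟩) h
    · exact h.elim id id
    · have h : Par x x := h.elim (fun h => h.2) (fun h => h.2)
      exact lt_irrefl _ (par_rk h)⟩

lemma card_hubs (a : ℕ) : (Finset.univ.filter (fun j : Fin k => a ≤ j.val)).card = k - a := by
  have h1 := Finset.card_filter_add_card_filter_not (s := (Finset.univ : Finset (Fin k)))
    (fun j => j.val < a)
  rw [Fin.card_filter_val_lt] at h1
  simp only [not_lt, Finset.card_univ, Fintype.card_fin] at h1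
  omega

open Classical in
lemma edges_nohub (S : Finset (Fin k ⊕ (Fin m × GX k z s n))) (hS : S.Nonempty)
    (hh : ∀ j, Sum.inl j ∉ S) :
    ((S ×ˢ S).filter (fun pq => RR pq.1 pq.2)).card + 1 ≤ S.card := by
  obtain ⟨p0, hp0, hmin⟩ := Finset.exists_min_image S
    (fun p => Sum.elim (fun _ => 0) (fun q => rk q.2) p) hS
  rw [← Finset.card_erase_add_one hp0]
  refine Nat.add_le_add_right (Finset.card_le_card_of_injOn Prod.fst ?_ ?_) 1
  · rintro ⟨p, q⟩ h
    simp only [Finset.coe_filter, Finset.mem_product, Set.mem_setOf_eq] at h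
    obtain ⟨⟨hp, hq⟩, h⟩ := h
    refine Finset.mem_coe.2 (Finset.mem_erase.2 ⟨?_, hp⟩)
    rintro rfl
    rcases p with j | ⟨c, y⟩
    · exact h.elim
    rcases q with j | ⟨c', x⟩
    · exact hh j hq
    · have h1 := hmin _ hq
      have h2 := par_rk h.2
      simp only [Sum.elim_inr] at h1
      omega
  · rintro ⟨p, q⟩ h ⟨p', q'⟩ h' hpp
    simp only [Finset.coe_filter, Finset.mem_product, Set.mem_setOf_eq] at h h' hpp
    subst hpp
    obtain ⟨⟨hp, hq⟩, h⟩ := h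
    obtain ⟨⟨-, hq'⟩, h'⟩ := h'
    rcases p with j | ⟨c, y⟩
    · exact h.elim
    rcases q with j | ⟨c1, x⟩
    · exact absurd hq (hh j)
    rcases q' with j | ⟨c2, x'⟩
    · exact absurd hq' (hh j)
    obtain ⟨rfl, h⟩ := h
    obtain ⟨rfl, h'⟩ := h'
    rw [par_unique h h']

open Classical in
lemma edges_hub (hk : 1 ≤ k) (hn : 1 ≤ n) {τ θ e : ℝ} (hτ : 0 ≤ τ) (hθ : θ = (z + 1) * τ)
    (hθ1 : θ ≤ 1)
    (he : 0 ≤ e) (hne : 2 * (n : ℝ) * e = θ) (hs : k * θ + s * τ + τ = k + 1 - θ)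
    (S : Finset (Fin k ⊕ (Fin m × GX k z s n))) (j0 : Fin k) (hj0 : Sum.inl j0 ∈ S) :
    (((S ×ˢ S).filter (fun pq => RR pq.1 pq.2)).card : ℝ) ≤
      (k + (1 - τ) + e) * (S.card - 1) := by
  set T : Finset (Fin m × GX k z s n) := Finset.univ.filter (fun p => Sum.inr p ∈ S) with hT
  have hTm : ∀ p, p ∈ T ↔ Sum.inr p ∈ S := fun p => by simp [hT]
  have hTS : (T.card : ℝ) ≤ S.card - 1 := by
    have h1 : T.card + 1 ≤ S.card := by
      rw [← Finset.card_erase_add_one hj0]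
      refine Nat.add_le_add_right (Finset.card_le_card_of_injOn Sum.inr ?_
        Sum.inr_injective.injOn) 1
      intro p hp
      exact Finset.mem_coe.2 (Finset.mem_erase.2 ⟨by simp, (hTm p).1 hp⟩)
    have : ((T.card + 1 : ℕ) : ℝ) ≤ S.card := by exact_mod_cast h1
    push_cast at this
    linarith
  have hw : ∀ y : GX k z s n, 0 ≤ wt τ θ e y ∧ wt τ θ e y ≤ 1 := wt_bounds hτ hθ hθ1 he hne
  -- split the edges
  set E2 : Finset ((Fin m × GX k z s n) × (Fin m × GX k z s n)) :=
    (T ×ˢ T).filter (fun pq => pq.1.1 = pq.2.1 ∧ Par pq.1.2 pq.2.2) with hE2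
  set E1 : Finset ((Fin m × GX k z s n) × Fin k) :=
    (T ×ˢ Finset.univ).filter (fun pq => cap pq.1.2 ≤ pq.2.val) with hE1
  have hsplit : ((S ×ˢ S).filter (fun pq => RR pq.1 pq.2)).card ≤ E1.card + E2.card := by
    have : (S ×ˢ S).filter (fun pq => RR pq.1 pq.2) ⊆
        E1.image (fun pq => (Sum.inr pq.1, Sum.inl pq.2)) ∪
        E2.image (fun pq => (Sum.inr pq.1, Sum.inr pq.2)) := by
      rintro ⟨p, q⟩ h
      obtain ⟨h, hr⟩ := Finset.mem_filter.1 h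
      obtain ⟨hp, hq⟩ := Finset.mem_product.1 h
      rcases p with j | ⟨c, y⟩
      · exact hr.elim
      rcases q with j | ⟨c', x⟩
      · exact Finset.mem_union_left _ (Finset.mem_image.2 ⟨((c, y), j),
          Finset.mem_filter.2 ⟨Finset.mem_product.2 ⟨(hTm _).2 hp, Finset.mem_univ _⟩, hr⟩, rfl⟩)
      · exact Finset.mem_union_right _ (Finset.mem_image.2 ⟨((c, y), (c', x)),
          Finset.mem_filter.2 ⟨Finset.mem_product.2 ⟨(hTm _).2 hp, (hTm _).2 hq⟩, hr⟩, rfl⟩)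
    exact (Finset.card_le_card this).trans ((Finset.card_union_le _ _).trans
      (Nat.add_le_add Finset.card_image_le Finset.card_image_le))
  have hE1c : (E1.card : ℝ) = ∑ p ∈ T, ((k : ℝ) - cap p.2) := by
    rw [hE1, Finset.card_filter, Finset.sum_product]
    push_cast
    refine Finset.sum_congr rfl fun p _ => ?_
    rw [Finset.sum_boole, card_hubs, Nat.cast_sub (cap_le hk _)]
  have hE2c : (E2.card : ℝ) ≤ ∑ p ∈ T, wt τ θ e p.2 +
      ∑ p ∈ T, ∑ y ∈ Finset.univ.filter (fun y => Par y p.2), (1 - wt τ θ e y) := by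
    have h0 : (E2.card : ℝ) = ∑ pq ∈ E2, wt τ θ e pq.1.2 + ∑ pq ∈ E2, (1 - wt τ θ e pq.1.2) := by
      rw [← Finset.sum_add_distrib]
      simp
    rw [h0]
    refine add_le_add ?_ ?_
    · rw [← Finset.sum_image (s := E2) (g := Prod.fst) (f := fun p => wt τ θ e p.2)]
      · refine Finset.sum_le_sum_of_subset_of_nonneg ?_ (fun p _ _ => (hw p.2).1)
        intro p hp
        obtain ⟨pq, hpq, rfl⟩ := Finset.mem_image.1 hp
        exact (Finset.mem_product.1 (Finset.mem_filter.1 hpq).1).1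
      · rintro ⟨⟨c, y⟩, ⟨c1, x⟩⟩ h ⟨⟨c', y'⟩, ⟨c2, x'⟩⟩ h' heq
        obtain ⟨-, h1, h2⟩ := Finset.mem_filter.1 h
        obtain ⟨-, h1', h2'⟩ := Finset.mem_filter.1 h'
        simp only [Prod.mk.injEq] at heq h1 h2 h1' h2'
        obtain ⟨rfl, rfl⟩ := heq
        subst h1 h1'
        rw [par_unique h2 h2']
    · rw [Finset.sum_sigma' T]
      rw [← Finset.sum_image (s := E2) (g := fun pq => (⟨pq.2, pq.1.2⟩ :
        Σ _ : Fin m × GX k z s n, GX k z s n)) (f := fun p => 1 - wt τ θ e p.2)]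
      · refine Finset.sum_le_sum_of_subset_of_nonneg ?_
          (fun p _ _ => by have := (hw p.2).2; linarith)
        intro p hp
        obtain ⟨pq, hpq, rfl⟩ := Finset.mem_image.1 hp
        obtain ⟨h1, -, h2⟩ := Finset.mem_filter.1 hpq
        exact Finset.mem_sigma.2 ⟨(Finset.mem_product.1 h1).2, by simpa using h2⟩
      · rintro ⟨⟨c, y⟩, ⟨c1, x⟩⟩ h ⟨⟨c', y'⟩, ⟨c2, x'⟩⟩ h' heq
        obtain ⟨-, h1, h2⟩ := Finset.mem_filter.1 h
        obtain ⟨-, h1', h2'⟩ := Finset.mem_filter.1 h'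
        simp only [Sigma.mk.injEq, Prod.mk.injEq, heq_eq_eq] at heq h1 h2 h1' h2'
        obtain ⟨⟨rfl, rfl⟩, rfl⟩ := heq
        subst h1 h1'
        rfl
  have hall : (E1.card : ℝ) + E2.card ≤ ∑ p ∈ T, ((k : ℝ) + (1 - τ) + e) := by
    rw [hE1c]
    refine (add_le_add_right hE2c _).trans ?_
    rw [← Finset.sum_add_distrib, ← Finset.sum_add_distrib]
    refine Finset.sum_le_sum fun p _ => ?_
    have := load_le hn hτ hθ hθ1 he hne hs p.2
    linarith
  have hsplit' : (((S ×ˢ S).filter (fun pq => RR pq.1 pq.2)).card : ℝ) ≤ E1.card + E2.card := by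
    exact_mod_cast hsplit
  rw [Finset.sum_const, nsmul_eq_mul] at hall
  have hpos : (0 : ℝ) ≤ k + (1 - τ) + e := by
    have : τ ≤ 1 := by
      have hz0 : (0 : ℝ) ≤ z := Nat.cast_nonneg z
      nlinarith
    have : (0 : ℝ) ≤ k := Nat.cast_nonneg k
    linarith
  nlinarith

/-- The density bound for the graph transported to `Fin N`. -/
lemma density {N : ℕ} (φ : Fin N ≃ (Fin k ⊕ (Fin m × GX k z s n)))
    (hk : 1 ≤ k) (hn : 1 ≤ n) {τ θ e : ℝ} (hτ : 0 ≤ τ) (hθ : θ = (z + 1) * τ)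
    (hθ1 : θ ≤ 1)
    (he : 0 ≤ e) (hne : 2 * (n : ℝ) * e = θ) (hs : k * θ + s * τ + τ = k + 1 - θ)
    (H : ((GV k z s n m).comap φ).Subgraph) (hH : 2 ≤ H.verts.ncard) :
    (H.edgeSet.ncard : ℝ) / (H.verts.ncard - 1) ≤ k + (1 - τ) + e := by
  classical
  set S : Finset (Fin k ⊕ (Fin m × GX k z s n)) :=
    Finset.univ.filter (fun p => φ.symm p ∈ H.verts) with hS
  have hSm : ∀ p, p ∈ S ↔ φ.symm p ∈ H.verts := fun p => by simp [hS]
  have hSc : S.card = H.verts.ncard := by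
    have : H.verts = ↑(S.map φ.symm.toEmbedding) := by
      ext v
      simp [hSm]
    rw [this, Set.ncard_coe_finset, Finset.card_map]
  have hE : H.edgeSet.ncard ≤ ((S ×ˢ S).filter (fun pq => RR pq.1 pq.2)).card := by
    have hsub : H.edgeSet ⊆ ↑(((S ×ˢ S).filter (fun pq => RR pq.1 pq.2)).image
        (fun pq => s(φ.symm pq.1, φ.symm pq.2))) := by
      intro ed
      induction ed using Sym2.ind with
      | _ a b =>
      intro h
      have h : H.Adj a b := h
      have ha := h.fst_mem
      have hb := h.snd_mem
      have hS' : φ a ∈ S := (hSm _).2 (by simpa using ha)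
      have hS'' : φ b ∈ S := (hSm _).2 (by simpa using hb)
      refine Finset.mem_coe.2 (Finset.mem_image.2 ?_)
      rcases h.adj_sub with h1 | h1
      · exact ⟨(φ a, φ b), Finset.mem_filter.2 ⟨Finset.mem_product.2 ⟨hS', hS''⟩, h1⟩, by simp⟩
      · exact ⟨(φ b, φ a), Finset.mem_filter.2 ⟨Finset.mem_product.2 ⟨hS'', hS'⟩, h1⟩,
          by simp [Sym2.eq_swap]⟩
    have := Set.ncard_le_ncard hsub (Set.toFinite _)
    rw [Set.ncard_coe_finset] at this
    exact this.trans Finset.card_image_le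
  have hE' : (H.edgeSet.ncard : ℝ) ≤ ((S ×ˢ S).filter (fun pq => RR pq.1 pq.2)).card := by
    exact_mod_cast hE
  have hv : (2 : ℝ) ≤ H.verts.ncard := by exact_mod_cast hH
  rw [div_le_iff₀ (by linarith), ← hSc]
  rw [← hSc] at hv
  by_cases hh : ∃ j, Sum.inl j ∈ S
  · obtain ⟨j0, hj0⟩ := hh
    exact hE'.trans (edges_hub hk hn hτ hθ hθ1 he hne hs S j0 hj0)
  · push Not at hh
    have h1 := edges_nohub S (Finset.card_pos.1 (by omega)) hh
    have h2 : (((S ×ˢ S).filter (fun pq => RR pq.1 pq.2)).card : ℝ) + 1 ≤ S.card := by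
      exact_mod_cast h1
    have : τ ≤ 1 := by
      have hz0 : (0 : ℝ) ≤ z := Nat.cast_nonneg z
      nlinarith
    have : (1 : ℝ) ≤ k := by exact_mod_cast hk
    nlinarith

end GX

namespace GX

variable {k z s n m : ℕ}

/-- The forcing part. -/
lemma forcing {N D : ℕ} (φ : Fin N ≃ (Fin k ⊕ (Fin m × GX k z s n)))
    (hk : 1 ≤ k) (hn : 1 ≤ n) (hm : k * (D + k) < m)
    (P : Fin (k + 1) → Set (Sym2 (Fin N)))
    (hP : IsPseudoforestDecomp ((GV k z s n m).comap φ) (k + 1) P) (i : Fin (k + 1))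
    (hD : ∀ v : Fin N, {e | e ∈ P i ∧ v ∈ e}.ncard ≤ D) :
    ∃ (K : (SimpleGraph.fromEdgeSet (P i)).ConnectedComponent) (u v : Fin N),
      u ∈ K.supp ∧ v ∈ K.supp ∧
        2 * z + 2 + s ≤ (compEdges (SimpleGraph.fromEdgeSet (P i)) K).ncard ∧
        2 * (z + 1) ≤ (SimpleGraph.fromEdgeSet (P i)).dist u v := by
  classical
  obtain ⟨own, hown, hownk⟩ := decomp_orient _ k P hP i
  set F := SimpleGraph.fromEdgeSet (P i) with hF
  have hFG : ∀ p q, F.Adj p q → RR (φ p) (φ q) ∨ RR (φ q) (φ p) := by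
    intro p q h
    have h1 := hP.1 i ((SimpleGraph.fromEdgeSet_adj _).1 h).1
    exact h1
  -- a good copy
  have hgood : ∃ c : Fin m, ∀ (x : GX k z s n) (j : Fin k),
      ¬ F.Adj (φ.symm (Sum.inl j)) (φ.symm (Sum.inr (c, x))) ∧
      ¬ own (φ.symm (Sum.inl j)) (φ.symm (Sum.inr (c, x))) := by
    by_contra hbad
    push Not at hbad
    choose f hf using hbad
    choose g hg using hf
    let B : Fin k → Finset (Fin N) := fun j => Finset.univ.filter
      (fun q => F.Adj (φ.symm (Sum.inl j)) q ∨ own (φ.symm (Sum.inl j)) q)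
    have hB : ∀ j, (B j).card ≤ D + k := by
      intro j
      have h1 : (Finset.univ.filter (fun q => F.Adj (φ.symm (Sum.inl j)) q)).card ≤ D := by
        refine le_trans ?_ (hD (φ.symm (Sum.inl j)))
        rw [← Set.ncard_coe_finset]
        refine Set.ncard_le_ncard_of_injOn (fun q => s(φ.symm (Sum.inl j), q)) ?_ ?_
          (Set.toFinite _)
        · intro q hq
          have hq : F.Adj (φ.symm (Sum.inl j)) q := by simpa using hq
          exact ⟨((SimpleGraph.fromEdgeSet_adj _).1 hq).1, by simp⟩
        · intro a _ b _ h
          exact Sym2.congr_right.1 h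
      have h2 : (Finset.univ.filter (fun q => own (φ.symm (Sum.inl j)) q)).card ≤ k := by
        refine le_trans (le_of_eq ?_) (hownk (φ.symm (Sum.inl j)))
        rw [← Set.ncard_coe_finset]
        simp
      have h3 : B j = Finset.univ.filter (fun q => F.Adj (φ.symm (Sum.inl j)) q) ∪
          Finset.univ.filter (fun q => own (φ.symm (Sum.inl j)) q) := by
        simp only [B, Finset.filter_or]
      rw [h3]
      exact (Finset.card_union_le _ _).trans (Nat.add_le_add h1 h2)
    have h4 : (Finset.univ.biUnion B).card ≤ k * (D + k) := by
      have := Finset.card_biUnion_le_card_mul Finset.univ B (D + k) (fun j _ => hB j)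
      simpa using this
    have h5 : (Finset.univ : Finset (Fin m)).card ≤ (Finset.univ.biUnion B).card := by
      refine Finset.card_le_card_of_injOn (fun c => φ.symm (Sum.inr (c, f c))) ?_ ?_
      · intro c _
        refine Finset.mem_coe.2 (Finset.mem_biUnion.2 ⟨g c, Finset.mem_univ _, ?_⟩)
        refine Finset.mem_filter.2 ⟨Finset.mem_univ _, ?_⟩
        by_cases h : F.Adj (φ.symm (Sum.inl (g c))) (φ.symm (Sum.inr (c, f c)))
        · exact Or.inl h
        · exact Or.inr (hg c h)
      · intro c _ c' _ h
        have h := Sum.inr_injective (φ.symm.injective h)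
        exact (Prod.mk.inj h).1
    simp only [Finset.card_univ, Fintype.card_fin] at h5
    omega
  obtain ⟨c, hc⟩ := hgood
  let ι : GX k z s n → Fin N := fun x => φ.symm (Sum.inr (c, x))
  have hιinj : Function.Injective ι := by
    intro x y h
    exact (Prod.mk.inj (Sum.inr_injective (φ.symm.injective h))).2
  have hφι : ∀ x, φ (ι x) = Sum.inr (c, x) := fun x => φ.apply_symm_apply _
  have hwin : Win (F.comap ι) := by
    refine core_win (ow := fun x y => own (ι x) (ι y)) hn ?_ ?_
    · intro y x hyx
      have : ((GV k z s n m).comap φ).Adj (ι y) (ι x) := by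
        change RR (φ (ι y)) (φ (ι x)) ∨ _
        rw [hφι, hφι]
        exact Or.inl ⟨rfl, hyx⟩
      exact hown _ _ this
    · intro x
      have h1 := hownk (ι x)
      let Y : Finset (GX k z s n) := Finset.univ.filter (fun y => own (ι x) (ι y))
      let J : Finset (Fin k) := Finset.univ.filter (fun j : Fin k => cap x ≤ j.val)
      have hJ : J.card = k - cap x := card_hubs _
      have hY : {y | own (ι x) (ι y)}.ncard = Y.card := by
        rw [← Set.ncard_coe_finset]; simp [Y]
      have hsub : (↑(Y.image ι ∪ J.image (fun j => φ.symm (Sum.inl j))) : Set (Fin N)) ⊆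
          {q | own (ι x) q} := by
        intro q hq
        rcases Finset.mem_union.1 (Finset.mem_coe.1 hq) with hq | hq
        · obtain ⟨y, hy, rfl⟩ := Finset.mem_image.1 hq
          exact (Finset.mem_filter.1 hy).2
        · obtain ⟨j, hj, rfl⟩ := Finset.mem_image.1 hq
          have hj := (Finset.mem_filter.1 hj).2
          have hadj : ((GV k z s n m).comap φ).Adj (ι x) (φ.symm (Sum.inl j)) := by
            change RR (φ (ι x)) (φ _) ∨ _
            rw [hφι, φ.apply_symm_apply]
            exact Or.inl hj
          rcases hown _ _ hadj with h | h | h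
          · exact absurd h.symm (hc x j).1
          · exact h
          · exact absurd h (hc x j).2
      have h2 := (Set.ncard_le_ncard hsub (Set.toFinite _)).trans h1
      rw [Set.ncard_coe_finset, Finset.card_union_of_disjoint, Finset.card_image_of_injective _ hιinj,
        Finset.card_image_of_injective _ (fun a b h => by simpa using h), hJ] at h2
      · have := cap_le hk x
        rw [hY]
        omega
      · rw [Finset.disjoint_left]
        intro q h h'
        obtain ⟨y, -, rfl⟩ := Finset.mem_image.1 h
        obtain ⟨j, -, h⟩ := Finset.mem_image.1 h'
        simp [ι] at h
  obtain ⟨w, u, v, A, g, hA, hu, hv, hAc, hg, hguv⟩ := hwin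
  have hreach : ∀ x ∈ A, F.Reachable (ι w) (ι x) := fun x hx =>
    (hA x hx).map (⟨ι, fun h => h⟩ : F.comap ι →g F)
  refine ⟨F.connectedComponentMk (ι w), ι u, ι v, ?_, ?_, ?_, ?_⟩
  · exact (SimpleGraph.ConnectedComponent.eq.2 (hreach u hu)).symm
  · exact (SimpleGraph.ConnectedComponent.eq.2 (hreach v hv)).symm
  · refine compEdges_ge F (ι w) (A.image ι) ?_ _ ?_
    · intro x hx
      obtain ⟨y, hy, rfl⟩ := Finset.mem_image.1 hx
      exact hreach y hy
    · rw [Finset.card_image_of_injective _ hιinj]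
      omega
  · let g' : Fin k ⊕ (Fin m × GX k z s n) → ℤ :=
      Sum.elim (fun _ => 0) (fun p => if p.1 = c then g p.2 else 0)
    have hlip : ∀ p q, F.Adj p q → RR (φ p) (φ q) → |g' (φ p) - g' (φ q)| ≤ 1 := by
      intro p q hadj hr
      obtain ⟨p', rfl⟩ := φ.symm.surjective p
      obtain ⟨q', rfl⟩ := φ.symm.surjective q
      rw [φ.apply_symm_apply, φ.apply_symm_apply] at hr ⊢
      rcases p' with j | ⟨c1, y⟩
      · exact hr.elim
      rcases q' with j | ⟨c2, x⟩
      · by_cases h : c1 = c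
        · subst h
          exact absurd hadj.symm (hc y j).1
        · simp [g', h]
      · obtain ⟨rfl, hr⟩ := hr
        by_cases h : c1 = c
        · simpa [g', h] using hg y x hr
        · simp [g', h]
    have h1 := lip_dist (H := F) (fun p => g' (φ p)) (fun p q hadj => by
      rcases hFG p q hadj with h | h
      · exact (abs_le.1 (hlip p q hadj h)).2
      · have := (abs_le.1 (hlip q p hadj.symm h)).1
        linarith) ((hreach u hu).symm.trans (hreach v hv))
    simp only [hφι] at h1
    simp only [g', Sum.elim_inr, if_true] at h1
    have : ((2 * (z + 1) : ℕ) : ℤ) ≤ F.dist (ι u) (ι v) := by push_cast; linarith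
    exact_mod_cast this

end GX

theorem lower_bound_diameter_of_big_components
    (k D d z : ℕ) (hk : 2 ≤ k) (hd : 1 ≤ d) (hz : z ≤ (d - 1) / (k + 1))
    (ε : ℝ) (hε : 0 < ε) :
    ∃ (n : ℕ) (G : SimpleGraph (Fin n)),
      (∀ H : G.Subgraph, 2 ≤ H.verts.ncard →
        (H.edgeSet.ncard : ℝ) / (H.verts.ncard - 1) <
          (k : ℝ) + (d : ℝ) / (d + k + 1) + ε) ∧
      ∀ P : Fin (k + 1) → Set (Sym2 (Fin n)), IsPseudoforestDecomp G (k + 1) P →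
        ∀ i : Fin (k + 1),
          (∀ v : Fin n, {e | e ∈ P i ∧ v ∈ e}.ncard ≤ D) →
          ∃ (K : (SimpleGraph.fromEdgeSet (P i)).ConnectedComponent) (u v : Fin n),
            u ∈ K.supp ∧ v ∈ K.supp ∧
              (d : ℤ) - z * ((k : ℤ) - 1) + 1 ≤
                ((compEdges (SimpleGraph.fromEdgeSet (P i)) K).ncard : ℤ) ∧
              2 * (z + 1) ≤ (SimpleGraph.fromEdgeSet (P i)).dist u v := by
  have hz' : z * (k + 1) ≤ d - 1 := (Nat.le_div_iff_mul_le (Nat.succ_pos k)).1 hz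
  obtain ⟨s, hs⟩ : ∃ s, d = z * (k + 1) + 1 + s := ⟨d - 1 - z * (k + 1), by omega⟩
  obtain ⟨n0, hn0⟩ := exists_nat_gt (1 / ε)
  set n := n0 + 1 with hn
  have hnε : 1 < ε * n := by
    rw [div_lt_iff₀ hε] at hn0
    have : (n : ℝ) = n0 + 1 := by rw [hn]; push_cast; ring
    rw [this]
    nlinarith
  have hnpos : (0 : ℝ) < n := by rw [hn]; positivity
  set m := k * (D + k) + 1 with hm
  let φ := (Fintype.equivFin (Fin k ⊕ (Fin m × GX k z s n))).symm
  have hdR : (d : ℝ) = z * (k + 1) + 1 + s := by rw [hs]; push_cast; ring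
  have hMpos : (0 : ℝ) < d + k + 1 := by positivity
  set τ : ℝ := (k + 1) / (d + k + 1) with hτ
  have hτM : τ * (d + k + 1) = k + 1 := by rw [hτ]; field_simp
  have hτ0 : 0 ≤ τ := by positivity
  have hβ : (d : ℝ) / (d + k + 1) = 1 - τ := by rw [hτ]; field_simp; ring
  set θ : ℝ := (z + 1) * τ with hθ
  have hθ1 : θ ≤ 1 := by
    have : θ = ((z + 1) * (k + 1)) / (d + k + 1) := by rw [hθ, hτ]; ring
    rw [this, div_le_one hMpos, hdR]
    have : (0 : ℝ) ≤ s := Nat.cast_nonneg s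
    nlinarith
  have hθ0 : 0 ≤ θ := by positivity
  have hload : k * θ + s * τ + τ = k + 1 - θ := by
    rw [← hτM, hdR, hθ]; ring
  set e : ℝ := θ / (2 * n) with he
  have he0 : 0 ≤ e := by positivity
  have hne : 2 * (n : ℝ) * e = θ := by rw [he]; field_simp
  have heε : e < ε := by
    rw [he, div_lt_iff₀ (by positivity)]
    nlinarith
  refine ⟨_, (GX.GV k z s n m).comap φ, ?_, ?_⟩
  · intro H hH
    have := GX.density φ (by omega) (by omega) hτ0 hθ hθ1 he0 hne hload H hH
    rw [hβ]
    linarith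
  · intro P hP i hD
    obtain ⟨K, u, v, hu, hv, h1, h2⟩ :=
      GX.forcing (D := D) φ (by omega) (by omega) (by omega) P hP i hD
    refine ⟨K, u, v, hu, hv, ?_, h2⟩
    have h1' : ((2 * z + 2 + s : ℕ) : ℤ) ≤
        ((compEdges (SimpleGraph.fromEdgeSet (P i)) K).ncard : ℤ) := by exact_mod_cast h1
    refine le_trans (le_of_eq ?_) h1'
    rw [hs]
    push_cast
    ring
end
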